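/- arXiv:2506.01677 — 3 statements merged into one kernel-verified Lean document; each statement's English description precedes it below -/
import Mathlib

section
/- (Estimation on translations for Bessel potential spaces.) Let n ≥ 2. There exists a constant C > 0, depending only on n and independent of s and p, such that for every s ∈ (0,1), every 1 ≤ p < ∞, every h ∈ ℝⁿ, and every u ∈ C_c^∞(ℝⁿ), ‖u(· + h) − u‖_{L^p(ℝⁿ)} ≤ (C/(s(1−s))) |h|^s ‖D^s u‖_{L^p(ℝⁿ;ℝⁿ)}. -/
open MeasureTheory Filter ENNReal

noncomputable section


/-- The normalization constant `c_{n,s}` of the Riesz fractional gradient. -/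
def cns (n : ℕ) (s : ℝ) : ℝ :=
  ((n : ℝ) + s - 1) * Real.Gamma (((n : ℝ) + s - 1) / 2) /
    (Real.pi ^ ((n : ℝ) / 2) * (2 : ℝ) ^ (1 - s) * Real.Gamma ((1 - s) / 2))

/-- The Riesz fractional gradient
`D^s u (x) = c_{n,s} ∫ (u(x) - u(y))/|x-y|^{n+s} ⬝ (x-y)/|x-y| dy`. -/
def rieszGrad (n : ℕ) (s : ℝ) (u : EuclideanSpace ℝ (Fin n) → ℝ)
    (x : EuclideanSpace ℝ (Fin n)) : EuclideanSpace ℝ (Fin n) :=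
  cns n s • ∫ y, ((u x - u y) / ‖x - y‖ ^ ((n : ℝ) + s + 1)) • (x - y)


def Gk (n : ℕ) (t : ℝ) (z : EuclideanSpace ℝ (Fin n)) : EuclideanSpace ℝ (Fin n) :=
  (2 * Real.pi * t ^ (-(n : ℝ) / 2 - 1) * Real.exp (-(Real.pi / t) * ‖z‖ ^ 2)) • z

lemma aux_exp1 (x : ℝ) : x ≤ Real.exp (Real.pi / 2 * x ^ 2) := by
  have h := Real.add_one_le_exp (Real.pi / 2 * x ^ 2)
  nlinarith [Real.pi_gt_three, sq_nonneg (x - 1), sq_nonneg x]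

lemma aux_exp2 (x : ℝ) : x ^ 2 ≤ Real.exp (Real.pi / 2 * x ^ 2) := by
  have h := Real.add_one_le_exp (Real.pi / 2 * x ^ 2)
  nlinarith [Real.pi_gt_three, sq_nonneg x]

lemma aux_exp3 (x : ℝ) : 1 + 2 * Real.pi * x ^ 2 ≤ 4 * Real.exp (Real.pi / 2 * x ^ 2) := by
  have h := Real.add_one_le_exp (Real.pi / 2 * x ^ 2)
  nlinarith [Real.pi_gt_three, sq_nonneg x]

lemma aux_exp_split {t : ℝ} (ht : 0 < t) (r : ℝ) :
    Real.exp (Real.pi / 2 * (r / √t) ^ 2) * Real.exp (-(Real.pi / t) * r ^ 2)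
      = Real.exp (-(Real.pi / (2 * t)) * r ^ 2) := by
  rw [← Real.exp_add]
  congr 1
  rw [div_pow, Real.sq_sqrt ht.le]
  field_simp
  ring

lemma Gk_norm (n : ℕ) {t : ℝ} (ht : 0 < t) (z : EuclideanSpace ℝ (Fin n)) :
    ‖Gk n t z‖ = 2 * Real.pi * t ^ (-(n : ℝ) / 2 - 1) * Real.exp (-(Real.pi / t) * ‖z‖ ^ 2) * ‖z‖ := by
  rw [Gk, norm_smul, Real.norm_of_nonneg (by positivity)]

lemma Gk_norm_le (n : ℕ) {t : ℝ} (ht : 0 < t) (z : EuclideanSpace ℝ (Fin n)) :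
    ‖Gk n t z‖ ≤ 2 * Real.pi * t ^ (-(n : ℝ) / 2 - 1 / 2) *
      Real.exp (-(Real.pi / (2 * t)) * ‖z‖ ^ 2) := by
  rw [Gk_norm n ht, ← aux_exp_split ht]
  have h1 := aux_exp1 (‖z‖ / √t)
  have hs : 0 < √t := Real.sqrt_pos.2 ht
  have h2 : t ^ (-(n : ℝ) / 2 - 1 / 2) = t ^ (-(n : ℝ) / 2 - 1) * √t := by
    rw [Real.sqrt_eq_rpow, ← Real.rpow_add ht]; congr 1; ring
  rw [h2]
  rw [div_le_iff₀ hs] at h1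
  have := mul_le_mul_of_nonneg_left h1 (show 0 ≤ 2 * Real.pi * t ^ (-(n : ℝ) / 2 - 1) * Real.exp (-(Real.pi / t) * ‖z‖ ^ 2) by positivity)
  linarith

lemma norm_mul_Gk_norm_le (n : ℕ) {t : ℝ} (ht : 0 < t) (z : EuclideanSpace ℝ (Fin n)) :
    ‖z‖ * ‖Gk n t z‖ ≤ 2 * Real.pi * t ^ (-(n : ℝ) / 2) *
      Real.exp (-(Real.pi / (2 * t)) * ‖z‖ ^ 2) := by
  rw [Gk_norm n ht, ← aux_exp_split ht]
  have h1 := aux_exp2 (‖z‖ / √t)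
  have hs : 0 < √t := Real.sqrt_pos.2 ht
  have h2 : t ^ (-(n : ℝ) / 2) = t ^ (-(n : ℝ) / 2 - 1) * t := by
    rw [← Real.rpow_add_one ht.ne']; congr 1; ring
  rw [h2]
  rw [div_pow, div_le_iff₀ (by positivity), Real.sq_sqrt ht.le, ← Real.sq_sqrt ht.le, ← div_pow, Real.sq_sqrt ht.le] at h1
  have := mul_le_mul_of_nonneg_left h1 (show 0 ≤ 2 * Real.pi * t ^ (-(n : ℝ) / 2 - 1) * Real.exp (-(Real.pi / t) * ‖z‖ ^ 2) by positivity)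
  linarith

lemma Gk_diff_le (n : ℕ) {t : ℝ} (ht : 0 < t) (z h : EuclideanSpace ℝ (Fin n)) (hh : ‖h‖ ≤ √t) :
    ‖Gk n t (z + h) - Gk n t z‖ ≤ 8 * Real.pi * Real.exp (Real.pi / 2) * t ^ (-(n : ℝ) / 2 - 1) * ‖h‖ *
      Real.exp (-(Real.pi / (4 * t)) * ‖z‖ ^ 2) := by
  have hs : 0 < √t := Real.sqrt_pos.2 ht
  obtain ⟨c, hc⟩ : ∃ c, c = 2 * Real.pi * t ^ (-(n : ℝ) / 2 - 1) := ⟨_, rfl⟩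
  have hc0 : 0 ≤ c := by rw [hc]; positivity
  have key := norm_image_sub_le_of_norm_deriv_le_segment_01'
    (f := fun θ : ℝ => Gk n t (z + θ • h))
    (f' := fun θ : ℝ => (c * Real.exp (-(Real.pi / t) * ‖z + θ • h‖ ^ 2)) • h +
      (c * (Real.exp (-(Real.pi / t) * ‖z + θ • h‖ ^ 2) *
        (-(Real.pi / t) * (2 * inner ℝ (z + θ • h) h)))) • (z + θ • h))
    (C := 8 * Real.pi * Real.exp (Real.pi / 2) * t ^ (-(n : ℝ) / 2 - 1) * ‖h‖ *
      Real.exp (-(Real.pi / (4 * t)) * ‖z‖ ^ 2)) ?_ ?_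
  · simpa using key
  · intro θ _
    apply HasDerivAt.hasDerivWithinAt
    have h1 : HasDerivAt (fun θ : ℝ => z + θ • h) h θ := by
      simpa using ((hasDerivAt_id θ).smul_const h).const_add z
    have h2 := h1.norm_sq
    unfold Gk
    rw [← hc]
    exact (((h2.const_mul (-(Real.pi / t))).exp.const_mul c).smul h1)
  · intro θ hθ
    set w := z + θ • h with hw
    have hzw : ‖z‖ ≤ ‖w‖ + √t := by
      have : z = w - θ • h := by simp [hw]
      rw [this]
      refine (norm_sub_le _ _).trans ?_
      gcongr
      rw [norm_smul, Real.norm_of_nonneg hθ.1]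
      nlinarith [norm_nonneg h, hθ.2, hθ.1]
    have hzw2 : ‖z‖ ^ 2 ≤ 2 * ‖w‖ ^ 2 + 2 * t := by
      nlinarith [Real.sq_sqrt ht.le, sq_nonneg (‖w‖ - √t), norm_nonneg z, norm_nonneg w]
    have hexp : Real.exp (-(Real.pi / (2 * t)) * ‖w‖ ^ 2) ≤ Real.exp (Real.pi / 2) * Real.exp (-(Real.pi / (4 * t)) * ‖z‖ ^ 2) := by
      rw [← Real.exp_add, Real.exp_le_exp]
      have h3 : Real.pi / (4 * t) * ‖z‖ ^ 2 ≤ Real.pi / (4 * t) * (2 * ‖w‖ ^ 2 + 2 * t) := by gcongr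
      have h4 : Real.pi / (4 * t) * (2 * ‖w‖ ^ 2 + 2 * t) = Real.pi / (2 * t) * ‖w‖ ^ 2 + Real.pi / 2 := by
        field_simp; ring
      linarith
    set e := Real.exp (-(Real.pi / t) * ‖w‖ ^ 2) with he
    have he0 : 0 < e := Real.exp_pos _
    calc _ ≤ c * e * ‖h‖ + c * (e * (Real.pi / t * (2 * (‖w‖ * ‖h‖)))) * ‖w‖ := by
          refine (norm_add_le _ _).trans ?_
          rw [norm_smul, norm_smul, Real.norm_of_nonneg (by positivity)]
          gcongr
          rw [norm_mul, norm_mul, norm_mul, norm_mul, norm_neg, Real.norm_of_nonneg hc0, Real.norm_of_nonneg he0.le,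
            Real.norm_of_nonneg (show 0 ≤ Real.pi / t by positivity), Real.norm_of_nonneg (show (0:ℝ) ≤ 2 by norm_num)]
          gcongr
          exact norm_inner_le_norm _ _
      _ = c * ‖h‖ * ((1 + 2 * Real.pi * (‖w‖ / √t) ^ 2) * e) := by
          rw [div_pow, Real.sq_sqrt ht.le]; field_simp
      _ ≤ c * ‖h‖ * (4 * Real.exp (Real.pi / 2 * (‖w‖ / √t) ^ 2) * e) := by
          gcongr; exact aux_exp3 _
      _ = c * ‖h‖ * 4 * Real.exp (-(Real.pi / (2 * t)) * ‖w‖ ^ 2) := by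
          rw [← aux_exp_split ht]; ring
      _ ≤ c * ‖h‖ * 4 * (Real.exp (Real.pi / 2) * Real.exp (-(Real.pi / (4 * t)) * ‖z‖ ^ 2)) := by
          gcongr
      _ = _ := by rw [hc]; ring

lemma gauss_integrable (n : ℕ) {b : ℝ} (hb : 0 < b) :
    Integrable (fun z : EuclideanSpace ℝ (Fin n) => Real.exp (-b * ‖z‖ ^ 2)) := by
  have := (GaussianFourier.integrable_cexp_neg_mul_sq_norm_add (V := EuclideanSpace ℝ (Fin n)) (b := (b : ℂ)) (by simpa using hb) 0 0).norm
  refine this.congr (Eventually.of_forall fun z => ?_)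
  simp only [Complex.norm_exp]
  norm_num
  left
  norm_cast

lemma gauss_integral (n : ℕ) {k t : ℝ} (hk : 0 < k) (ht : 0 < t) :
    ∫ z : EuclideanSpace ℝ (Fin n), Real.exp (-(Real.pi / (k * t)) * ‖z‖ ^ 2) = k ^ ((n : ℝ) / 2) * t ^ ((n : ℝ) / 2) := by
  rw [GaussianFourier.integral_rexp_neg_mul_sq_norm (by positivity)]
  have : Real.pi / (Real.pi / (k * t)) = k * t := by field_simp
  rw [this, finrank_euclideanSpace_fin, Real.mul_rpow hk.le ht.le]

lemma gauss_lintegral (n : ℕ) {k t c : ℝ} (hk : 0 < k) (ht : 0 < t) (hc : 0 ≤ c) :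
    ∫⁻ z : EuclideanSpace ℝ (Fin n), ENNReal.ofReal (c * Real.exp (-(Real.pi / (k * t)) * ‖z‖ ^ 2))
      = ENNReal.ofReal (c * (k ^ ((n : ℝ) / 2) * t ^ ((n : ℝ) / 2))) := by
  rw [← ofReal_integral_eq_lintegral_ofReal, integral_const_mul, gauss_integral n hk ht]
  · exact (gauss_integrable n (by positivity)).const_mul _
  · exact Eventually.of_forall fun z => by positivity

lemma Gk_continuous (n : ℕ) (t : ℝ) : Continuous (Gk n t) := by
  unfold Gk; fun_prop

lemma Gk_measurable (n : ℕ) : Measurable (fun q : ℝ × EuclideanSpace ℝ (Fin n) => Gk n q.1 q.2) := by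
  unfold Gk
  fun_prop

lemma lintegral_Gk_le (n : ℕ) {t : ℝ} (ht : 0 < t) :
    ∫⁻ z, ‖Gk n t z‖ₑ ≤ ENNReal.ofReal (2 * Real.pi * 2 ^ ((n : ℝ) / 2) * t ^ (-(1 / 2) : ℝ)) := by
  calc _ ≤ ∫⁻ z : EuclideanSpace ℝ (Fin n), ENNReal.ofReal (2 * Real.pi * t ^ (-(n : ℝ) / 2 - 1 / 2) *
      Real.exp (-(Real.pi / (2 * t)) * ‖z‖ ^ 2)) := by
        apply lintegral_mono
        intro z
        simp only
        rw [← ofReal_norm]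
        exact ENNReal.ofReal_le_ofReal (Gk_norm_le n ht z)
    _ = _ := by
        rw [gauss_lintegral n two_pos ht (by positivity)]
        congr 1
        have : t ^ (-(1 / 2) : ℝ) = t ^ (-(n : ℝ) / 2 - 1 / 2) * t ^ ((n : ℝ) / 2) := by
          rw [← Real.rpow_add ht]; congr 1; ring
        rw [this]; ring

lemma lintegral_norm_Gk_le (n : ℕ) {t : ℝ} (ht : 0 < t) :
    ∫⁻ z, ‖z‖ₑ * ‖Gk n t z‖ₑ ≤ ENNReal.ofReal (2 * Real.pi * 2 ^ ((n : ℝ) / 2)) := by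
  calc _ ≤ ∫⁻ z : EuclideanSpace ℝ (Fin n), ENNReal.ofReal (2 * Real.pi * t ^ (-(n : ℝ) / 2) *
      Real.exp (-(Real.pi / (2 * t)) * ‖z‖ ^ 2)) := by
        apply lintegral_mono
        intro z
        simp only
        rw [← ofReal_norm, ← ofReal_norm, ← ENNReal.ofReal_mul (norm_nonneg _)]
        exact ENNReal.ofReal_le_ofReal (norm_mul_Gk_norm_le n ht z)
    _ = _ := by
        rw [gauss_lintegral n two_pos ht (by positivity)]
        congr 1
        have : t ^ (-(n : ℝ) / 2) * t ^ ((n : ℝ) / 2) = 1 := by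
          rw [← Real.rpow_add ht]; ring_nf; simp
        calc _ = 2 * Real.pi * 2 ^ ((n : ℝ) / 2) * (t ^ (-(n : ℝ) / 2) * t ^ ((n : ℝ) / 2)) := by ring
          _ = _ := by rw [this, mul_one]

lemma lintegral_Gk_diff_le (n : ℕ) {t : ℝ} (ht : 0 < t) (h : EuclideanSpace ℝ (Fin n)) :
    ∫⁻ z, ‖Gk n t (z + h) - Gk n t z‖ₑ ≤ ENNReal.ofReal (4 * Real.pi * 2 ^ ((n : ℝ) / 2) * t ^ (-(1 / 2) : ℝ)) := by
  calc _ ≤ ∫⁻ z, (‖Gk n t (z + h)‖ₑ + ‖Gk n t z‖ₑ) := lintegral_mono fun z => enorm_sub_le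
    _ = (∫⁻ z, ‖Gk n t z‖ₑ) + ∫⁻ z, ‖Gk n t z‖ₑ := by
        rw [lintegral_add_right _ (Gk_continuous n t).measurable.enorm]
        congr 1
        exact lintegral_add_right_eq_self (fun z => ‖Gk n t z‖ₑ) h
    _ ≤ _ := by
        refine (add_le_add (lintegral_Gk_le n ht) (lintegral_Gk_le n ht)).trans ?_
        rw [← ENNReal.ofReal_add (by positivity) (by positivity)]
        apply ENNReal.ofReal_le_ofReal
        linarith

lemma lintegral_Gk_diff_le' (n : ℕ) {t : ℝ} (ht : 0 < t) (h : EuclideanSpace ℝ (Fin n)) (hh : ‖h‖ ≤ √t) :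
    ∫⁻ z, ‖Gk n t (z + h) - Gk n t z‖ₑ ≤
      ENNReal.ofReal (8 * Real.pi * Real.exp (Real.pi / 2) * 4 ^ ((n : ℝ) / 2) * ‖h‖ * t ^ (-1 : ℝ)) := by
  calc _ ≤ ∫⁻ z : EuclideanSpace ℝ (Fin n), ENNReal.ofReal (8 * Real.pi * Real.exp (Real.pi / 2) * t ^ (-(n : ℝ) / 2 - 1) * ‖h‖ *
      Real.exp (-(Real.pi / (4 * t)) * ‖z‖ ^ 2)) := by
        apply lintegral_mono
        intro z
        simp only
        rw [← ofReal_norm]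
        exact ENNReal.ofReal_le_ofReal (Gk_diff_le n ht z h hh)
    _ = _ := by
        rw [gauss_lintegral n (by norm_num) ht (by positivity)]
        congr 1
        have : t ^ (-1 : ℝ) = t ^ (-(n : ℝ) / 2 - 1) * t ^ ((n : ℝ) / 2) := by
          rw [← Real.rpow_add ht]; congr 1; ring
        rw [this]; ring

lemma Gk_integrable (n : ℕ) {t : ℝ} (ht : 0 < t) : Integrable (Gk n t) :=
  ⟨(Gk_continuous n t).aestronglyMeasurable, (lintegral_Gk_le n ht).trans_lt ENNReal.ofReal_lt_top⟩

lemma lint_low {a r c : ℝ} (ha : 0 < a) (hr : 0 < r) (hc : 0 ≤ c) :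
    ∫⁻ t in Set.Ioc 0 a, ENNReal.ofReal (c * t ^ (r - 1)) = ENNReal.ofReal (c * (a ^ r / r)) := by
  have hi : IntegrableOn (fun t : ℝ => t ^ (r - 1)) (Set.Ioc 0 a) := by
    have := intervalIntegral.intervalIntegrable_rpow' (a := 0) (b := a) (r := r - 1) (by linarith)
    rwa [intervalIntegrable_iff_integrableOn_Ioc_of_le ha.le] at this
  rw [← ofReal_integral_eq_lintegral_ofReal (hi.const_mul c), integral_const_mul,
    ← intervalIntegral.integral_of_le ha.le, integral_rpow (Or.inl (by linarith))]
  · simp [Real.zero_rpow hr.ne']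
  · filter_upwards [ae_restrict_mem measurableSet_Ioc] with t ht
    have := ht.1
    positivity

lemma lint_high {a r c : ℝ} (ha : 0 < a) (hr : 0 < r) (hc : 0 ≤ c) :
    ∫⁻ t in Set.Ioi a, ENNReal.ofReal (c * t ^ (-r - 1)) = ENNReal.ofReal (c * (a ^ (-r) / r)) := by
  have hi : IntegrableOn (fun t : ℝ => t ^ (-r - 1)) (Set.Ioi a) :=
    integrableOn_Ioi_rpow_of_lt (by linarith) ha
  rw [← ofReal_integral_eq_lintegral_ofReal (hi.const_mul c), integral_const_mul,
    integral_Ioi_rpow_of_lt (by linarith) ha]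
  · simp only [sub_add_cancel, neg_div_neg_eq]
  · filter_upwards [ae_restrict_mem measurableSet_Ioi] with t ht
    have := ha.trans ht
    positivity

lemma lint_mix {a r₁ r₂ c₁ c₂ : ℝ} (ha : 0 < a) (hr₁ : 0 < r₁) (hr₂ : 0 < r₂) (hc₁ : 0 ≤ c₁) (hc₂ : 0 ≤ c₂)
    {φ : ℝ → ℝ≥0∞} (h₁ : ∀ t, 0 < t → t ≤ a → φ t ≤ ENNReal.ofReal (c₁ * t ^ (r₁ - 1)))
    (h₂ : ∀ t, a < t → φ t ≤ ENNReal.ofReal (c₂ * t ^ (-r₂ - 1))) :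
    ∫⁻ t in Set.Ioi 0, φ t ≤ ENNReal.ofReal (c₁ * (a ^ r₁ / r₁) + c₂ * (a ^ (-r₂) / r₂)) := by
  rw [← Set.Ioc_union_Ioi_eq_Ioi ha.le, ENNReal.ofReal_add (by positivity) (by positivity),
    ← lint_low ha hr₁ hc₁, ← lint_high ha hr₂ hc₂]
  refine (lintegral_union_le _ _ _).trans (add_le_add ?_ ?_)
  · exact setLIntegral_mono' measurableSet_Ioc fun t ht => h₁ t ht.1 ht.2
  · exact setLIntegral_mono' measurableSet_Ioi fun t ht => h₂ t ht

lemma young (n : ℕ) {p : ℝ} (hp : 1 ≤ p) {k F : EuclideanSpace ℝ (Fin n) → ℝ≥0∞}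
    (hk : Measurable k) (hF : Measurable F) :
    (∫⁻ x, (∫⁻ y, k (x - y) * F y) ^ p) ^ (1 / p) ≤ (∫⁻ z, k z) * (∫⁻ y, F y ^ p) ^ (1 / p) := by
  have hp0 : 0 < p := by linarith
  have h1p : 1 / p ≤ 1 := by rw [div_le_one hp0]; exact hp
  have step : ∀ x, (∫⁻ y, k (x - y) * F y) ^ p ≤ (∫⁻ z, k z) ^ (p - 1) * ∫⁻ y, k (x - y) * F y ^ p := by
    intro x
    have hkx : Measurable fun y => k (x - y) := hk.comp (measurable_const.sub measurable_id)
    have := ENNReal.lintegral_mul_norm_pow_le (μ := volume) (f := fun y => k (x - y))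
      (g := fun y => k (x - y) * F y ^ p) hkx.aemeasurable (hkx.mul (hF.pow_const p)).aemeasurable
      (p := 1 - 1 / p) (q := 1 / p) (by linarith) (by positivity) (by ring)
    have e : ∀ y, k (x - y) ^ (1 - 1 / p) * (k (x - y) * F y ^ p) ^ (1 / p) = k (x - y) * F y := by
      intro y
      rw [ENNReal.mul_rpow_of_nonneg _ _ (by positivity), ← mul_assoc,
        ← ENNReal.rpow_add_of_nonneg _ _ (by linarith) (by positivity), ← ENNReal.rpow_mul]
      have e1 : p * (1 / p) = 1 := by field_simp
      have e2 : 1 - 1 / p + 1 / p = 1 := by ring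
      rw [e1, e2, ENNReal.rpow_one, ENNReal.rpow_one]
    simp only [e] at this
    have h2 := ENNReal.rpow_le_rpow this hp0.le
    rw [ENNReal.mul_rpow_of_nonneg _ _ hp0.le, ← ENNReal.rpow_mul, ← ENNReal.rpow_mul,
      lintegral_sub_left_eq_self] at h2
    have e1 : (1 - 1 / p) * p = p - 1 := by field_simp
    have e2 : 1 / p * p = 1 := by field_simp
    rwa [e1, e2, ENNReal.rpow_one] at h2
  have total : ∫⁻ x, (∫⁻ y, k (x - y) * F y) ^ p ≤ (∫⁻ z, k z) ^ p * ∫⁻ y, F y ^ p := by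
    have hm : Measurable (Function.uncurry fun x y : EuclideanSpace ℝ (Fin n) => k (x - y) * F y ^ p) := by
      apply Measurable.mul
      · exact hk.comp (measurable_fst.sub measurable_snd)
      · exact (hF.comp measurable_snd).pow_const p
    calc _ ≤ ∫⁻ x, (∫⁻ z, k z) ^ (p - 1) * ∫⁻ y, k (x - y) * F y ^ p := lintegral_mono step
      _ = (∫⁻ z, k z) ^ (p - 1) * ∫⁻ x, ∫⁻ y, k (x - y) * F y ^ p :=
          lintegral_const_mul _ hm.lintegral_prod_right'
      _ = (∫⁻ z, k z) ^ (p - 1) * ((∫⁻ z, k z) * ∫⁻ y, F y ^ p) := by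
          rw [lintegral_lintegral_swap hm.aemeasurable]
          congr 1
          rw [← lintegral_const_mul _ (hF.pow_const p)]
          apply lintegral_congr
          intro y
          rw [lintegral_mul_const _ (show Measurable fun x => k (x - y) from hk.comp (measurable_id.sub measurable_const))]
          congr 1
          exact lintegral_sub_right_eq_self k y
      _ = _ := by
          rw [← mul_assoc]
          congr 1
          have := ENNReal.rpow_add_of_nonneg (x := ∫⁻ z, k z) (p - 1) 1 (by linarith) (by norm_num)
          rw [ENNReal.rpow_one] at this
          rw [← this]; congr 1; ring
  refine (ENNReal.rpow_le_rpow total (by positivity)).trans ?_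
  rw [ENNReal.mul_rpow_of_nonneg _ _ (by positivity), ← ENNReal.rpow_mul]
  have e2 : p * (1 / p) = 1 := by field_simp
  rw [e2, ENNReal.rpow_one]

lemma lintegral_kernel_le (n : ℕ) {s : ℝ} (hs : 0 < s) (hs1 : s < 1) (h : EuclideanSpace ℝ (Fin n)) (hh : h ≠ 0) :
    ∫⁻ t in Set.Ioi (0 : ℝ), ∫⁻ z, ENNReal.ofReal (t ^ ((s - 1) / 2)) * ‖Gk n t (z + h) - Gk n t z‖ₑ ≤
      ENNReal.ofReal (2 * (4 * Real.pi * 2 ^ ((n : ℝ) / 2) + 8 * Real.pi * Real.exp (Real.pi / 2) * 4 ^ ((n : ℝ) / 2))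
        / (s * (1 - s)) * ‖h‖ ^ s) := by
  have hn : 0 < ‖h‖ := norm_pos_iff.2 hh
  have h1s : 0 < 1 - s := by linarith
  set c₁ := 4 * Real.pi * 2 ^ ((n : ℝ) / 2) with hc₁
  set c₂ := 8 * Real.pi * Real.exp (Real.pi / 2) * 4 ^ ((n : ℝ) / 2) with hc₂
  have hc₁0 : 0 ≤ c₁ := by positivity
  have hc₂0 : 0 ≤ c₂ := by positivity
  refine (lint_mix (a := ‖h‖ ^ 2) (r₁ := s / 2) (r₂ := (1 - s) / 2) (c₁ := c₁)
    (c₂ := c₂ * ‖h‖) (by positivity) (by positivity) (by positivity) hc₁0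
    (by positivity) ?_ ?_).trans ?_
  · intro t ht _
    rw [lintegral_const_mul' _ _ ENNReal.ofReal_ne_top]
    refine (mul_le_mul_right (lintegral_Gk_diff_le n ht h) _).trans ?_
    rw [← ENNReal.ofReal_mul (by positivity), ← hc₁]
    apply le_of_eq
    congr 1
    have : t ^ (s / 2 - 1) = t ^ ((s - 1) / 2) * t ^ (-(1 / 2) : ℝ) := by
      rw [← Real.rpow_add ht]; congr 1; ring
    rw [this]; ring
  · intro t ht'
    have ht : 0 < t := lt_trans (by positivity) ht'
    rw [lintegral_const_mul' _ _ ENNReal.ofReal_ne_top]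
    refine (mul_le_mul_right (lintegral_Gk_diff_le' n ht h (Real.le_sqrt_of_sq_le ht'.le)) _).trans ?_
    rw [← ENNReal.ofReal_mul (by positivity), ← hc₂]
    apply le_of_eq
    congr 1
    have : t ^ (-((1 - s) / 2) - 1) = t ^ ((s - 1) / 2) * t ^ (-1 : ℝ) := by
      rw [← Real.rpow_add ht]; congr 1; ring
    rw [this]; ring
  · apply ENNReal.ofReal_le_ofReal
    have e1 : (‖h‖ ^ 2) ^ (s / 2) = ‖h‖ ^ s := by
      rw [← Real.rpow_natCast, ← Real.rpow_mul hn.le]; congr 1; push_cast; ring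
    have e2 : ‖h‖ * (‖h‖ ^ 2) ^ (-((1 - s) / 2)) = ‖h‖ ^ s := by
      rw [← Real.rpow_natCast, ← Real.rpow_mul hn.le]
      nth_rewrite 1 [← Real.rpow_one ‖h‖]
      rw [← Real.rpow_add hn]; congr 1; push_cast; ring
    have : c₁ * ((‖h‖ ^ 2) ^ (s / 2) / (s / 2)) + c₂ * ‖h‖ * ((‖h‖ ^ 2) ^ (-((1 - s) / 2)) / ((1 - s) / 2))
      = 2 * (c₁ * (1 - s) + c₂ * s) / (s * (1 - s)) * ‖h‖ ^ s := by
      calc _ = c₁ * ((‖h‖ ^ 2) ^ (s / 2) / (s / 2)) + c₂ * ((‖h‖ * (‖h‖ ^ 2) ^ (-((1 - s) / 2))) / ((1 - s) / 2)) := by ring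
        _ = _ := by rw [e1, e2]; field_simp
    rw [this]
    gcongr <;> nlinarith

lemma fourier_Gk (n : ℕ) {t : ℝ} (ht : 0 < t) (a ξ : EuclideanSpace ℝ (Fin n)) :
    ∫ z, Complex.exp (((-2 * Real.pi * inner ℝ z ξ : ℝ) : ℂ) * Complex.I) * ((inner ℝ a (Gk n t z) : ℝ) : ℂ)
      = -(2 * Real.pi * Complex.I) * ((inner ℝ a ξ : ℝ) : ℂ) * ((Real.exp (-(Real.pi * ‖ξ‖ ^ 2) * t) : ℝ) : ℂ) := by
  set f : EuclideanSpace ℝ (Fin n) → ℂ := fun z =>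
    ((t ^ (-(n : ℝ) / 2) * Real.exp (-(Real.pi / t) * ‖z‖ ^ 2) : ℝ) : ℂ) with hf
  have hd : ∀ z, HasFDerivAt f (Complex.ofRealCLM.comp (-(innerSL ℝ (Gk n t z)))) z := by
    intro z
    have h1 : HasFDerivAt (fun z : EuclideanSpace ℝ (Fin n) => ‖z‖ ^ 2) _ z := (hasFDerivAt_id z).norm_sq
    have h2 := ((h1.const_mul (-(Real.pi / t))).exp.const_mul (t ^ (-(n : ℝ) / 2)))
    have h3 := Complex.ofRealCLM.hasFDerivAt.comp z h2
    refine h3.congr_fderiv ?_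
    congr 1
    ext v
    simp [Gk]
    have : t ^ (-(n : ℝ) / 2) = t ^ (-(n : ℝ) / 2 - 1) * t := by
      rw [← Real.rpow_add_one ht.ne']; congr 1; ring
    rw [this]
    field_simp
  have hfd : fderiv ℝ f = fun z => Complex.ofRealCLM.comp (-(innerSL ℝ (Gk n t z))) :=
    funext fun z => (hd z).fderiv
  have hint : Integrable f := ((gauss_integrable n (b := Real.pi / t) (by positivity)).const_mul _).ofReal
  have hint' : Integrable (fderiv ℝ f) := by
    rw [hfd]
    refine (Gk_integrable n ht).norm.mono' ?_ (Eventually.of_forall fun z => ?_)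
    · apply Continuous.aestronglyMeasurable
      have := Gk_continuous n t
      fun_prop
    · refine (ContinuousLinearMap.opNorm_comp_le _ _).trans ?_
      rw [norm_neg, innerSL_apply_norm, Complex.ofRealCLM_norm, one_mul]
  have key := congrFun (Real.fourier_fderiv hint (fun z => (hd z).differentiableAt) hint') ξ
  have key2 := congrArg (fun T => T a) key
  simp only [VectorFourier.fourierSMulRight_apply] at key2
  have hF : FourierTransform.fourier f ξ = ((Real.exp (-(Real.pi * ‖ξ‖ ^ 2) * t) : ℝ) : ℂ) := by
    have g := fourier_gaussian_innerProductSpace (V := EuclideanSpace ℝ (Fin n)) (b := ((Real.pi / t : ℝ) : ℂ)) (by rw [Complex.ofReal_re]; positivity) ξ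
    rw [Real.fourier_eq'] at g ⊢
    have : ∀ v, Complex.exp (((-2 * Real.pi * inner ℝ v ξ : ℝ) : ℂ) * Complex.I) • f v =
      ((t ^ (-(n : ℝ) / 2) : ℝ) : ℂ) * (Complex.exp (((-2 * Real.pi * inner ℝ v ξ : ℝ) : ℂ) * Complex.I) • Complex.exp (-((Real.pi / t : ℝ) : ℂ) * ‖v‖ ^ 2)) := by
      intro v
      simp only [hf, smul_eq_mul]
      push_cast
      ring
    simp only [this]
    rw [integral_const_mul, g, finrank_euclideanSpace_fin]
    have e1 : ((Real.pi : ℂ) / ((Real.pi / t : ℝ) : ℂ)) = ((t : ℝ) : ℂ) := by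
      rw [← Complex.ofReal_div]; congr 1; field_simp
    have e2 : -(Real.pi : ℂ) ^ 2 * ‖ξ‖ ^ 2 / ((Real.pi / t : ℝ) : ℂ) = ((-(Real.pi * ‖ξ‖ ^ 2) * t : ℝ) : ℂ) := by
      push_cast; field_simp
    have e3 : ((t : ℝ) : ℂ) ^ ((n : ℂ) / 2) = ((t ^ ((n : ℝ) / 2) : ℝ) : ℂ) := by
      rw [Complex.ofReal_cpow ht.le]; push_cast; rfl
    rw [e1, e2, e3, ← mul_assoc, ← Complex.ofReal_mul, ← Real.rpow_add ht, ← Complex.ofReal_exp]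
    have : -(n : ℝ) / 2 + n / 2 = 0 := by ring
    rw [this]; simp
  rw [hF, Real.fourier_eq', ContinuousLinearMap.integral_apply, hfd] at key2
  · have e : ∀ z, Complex.exp (((-2 * Real.pi * inner ℝ z ξ : ℝ) : ℂ) * Complex.I) * ((inner ℝ a (Gk n t z) : ℝ) : ℂ)
      = -((Complex.exp (((-2 * Real.pi * inner ℝ z ξ : ℝ) : ℂ) * Complex.I) • (Complex.ofRealCLM.comp (-(innerSL ℝ (Gk n t z))))) a) := by
      intro z
      simp [real_inner_comm]
    simp only [e]
    rw [integral_neg, key2]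
    have e4 : ((-innerSL ℝ) ξ) a = -(inner ℝ a ξ : ℝ) := by
      rw [real_inner_comm]; rfl
    rw [e4]
    simp only [smul_eq_mul, Complex.real_smul, Complex.ofReal_neg]
    ring
  · refine hint'.norm.mono' ?_ (Eventually.of_forall fun z => ?_)
    · refine AEStronglyMeasurable.fun_smul ?_ hint'.1
      exact (by fun_prop : Continuous fun z : EuclideanSpace ℝ (Fin n) => Complex.exp (((-2 * Real.pi * inner ℝ z ξ : ℝ) : ℂ) * Complex.I)).aestronglyMeasurable
    · rw [norm_smul, Complex.norm_exp_ofReal_mul_I, one_mul]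

lemma gamma_inv_int {β b : ℝ} (hβ : 0 < β) (hb : 0 < b) :
    ∫ t in Set.Ioi (0 : ℝ), t ^ (-β - 1) * Real.exp (-b / t) = b ^ (-β) * Real.Gamma β := by
  have h := integral_comp_rpow_Ioi (fun t : ℝ => t ^ (β - 1) * Real.exp (-(b * t))) (p := -1) (by norm_num)
  rw [Real.integral_rpow_mul_exp_neg_mul_Ioi hβ hb] at h
  rw [one_div, Real.inv_rpow hb.le, ← Real.rpow_neg hb.le] at h
  rw [← h]
  apply setIntegral_congr_fun measurableSet_Ioi
  intro t ht
  have ht : 0 < t := ht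
  simp only [smul_eq_mul]
  rw [← Real.rpow_mul ht.le, ← mul_assoc, abs_neg, abs_one, one_mul, ← Real.rpow_add ht, Real.rpow_neg_one]
  congr 2
  · ring
  · ring

lemma int_Gk (n : ℕ) {s : ℝ} (hs : 0 < s) (z : EuclideanSpace ℝ (Fin n)) :
    ∫ t in Set.Ioi (0 : ℝ), t ^ ((1 - s) / 2 - 1) • Gk n t z =
      (2 * Real.pi ^ ((1 - n - s) / 2) * Real.Gamma ((n + s + 1) / 2)) • ((1 / ‖z‖ ^ ((n : ℝ) + s + 1)) • z) := by
  by_cases hz : z = 0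
  · subst hz; simp [Gk]
  have hz' : 0 < ‖z‖ := norm_pos_iff.2 hz
  have e : ∀ t ∈ Set.Ioi (0 : ℝ), t ^ ((1 - s) / 2 - 1) • Gk n t z =
      (2 * Real.pi * (t ^ (-((n + s + 1) / 2) - 1) * Real.exp (-(Real.pi * ‖z‖ ^ 2) / t))) • z := by
    intro t ht
    have ht : 0 < t := ht
    rw [Gk, smul_smul]
    congr 1
    have : t ^ (-(((n : ℝ) + s + 1) / 2) - 1) = t ^ ((1 - s) / 2 - 1) * t ^ (-(n : ℝ) / 2 - 1) := by
      rw [← Real.rpow_add ht]; congr 1; ring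
    rw [this]
    have : -(Real.pi * ‖z‖ ^ 2) / t = -(Real.pi / t) * ‖z‖ ^ 2 := by ring
    rw [this]; ring
  rw [setIntegral_congr_fun measurableSet_Ioi e, integral_smul_const, integral_const_mul,
    gamma_inv_int (by positivity) (by positivity), smul_smul]
  congr 1
  rw [Real.mul_rpow Real.pi_pos.le (by positivity), ← Real.rpow_natCast, ← Real.rpow_mul hz'.le, one_div, ← Real.rpow_neg hz'.le]
  have e1 : Real.pi ^ ((1 - n - s) / 2) = Real.pi * Real.pi ^ (-(((n : ℝ) + s + 1) / 2)) := by
    nth_rewrite 2 [← Real.rpow_one Real.pi]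
    rw [← Real.rpow_add Real.pi_pos]; congr 1; ring
  have e2 : ((2 : ℕ) : ℝ) * -(((n : ℝ) + s + 1) / 2) = -((n : ℝ) + s + 1) := by push_cast; ring
  rw [e1, e2]
  ring

lemma gamma_int {α b : ℝ} (hα : 0 < α) (hb : 0 < b) :
    ∫ t in Set.Ioi (0 : ℝ), t ^ (α - 1) * Real.exp (-b * t) = b ^ (-α) * Real.Gamma α := by
  have h := Real.integral_rpow_mul_exp_neg_mul_Ioi hα hb
  rw [one_div, Real.inv_rpow hb.le, ← Real.rpow_neg hb.le] at h
  rw [← h]; simp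

lemma gamma_integrable {α b : ℝ} (hα : 0 < α) (hb : 0 < b) :
    IntegrableOn (fun t : ℝ => t ^ (α - 1) * Real.exp (-b * t)) (Set.Ioi 0) := by
  have := integrableOn_rpow_mul_exp_neg_mul_rpow (p := 1) (s := α - 1) (b := b) (by linarith) one_pos hb
  simpa using this

def ee (n : ℕ) (x ξ : EuclideanSpace ℝ (Fin n)) : ℂ :=
  Complex.exp (((2 * Real.pi * inner ℝ ξ x : ℝ) : ℂ) * Complex.I)

lemma ee_norm (n : ℕ) (x ξ : EuclideanSpace ℝ (Fin n)) : ‖ee n x ξ‖ = 1 := by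
  rw [ee, Complex.norm_exp_ofReal_mul_I]

lemma ee_continuous (n : ℕ) {X : Type*} [TopologicalSpace X] {f g : X → EuclideanSpace ℝ (Fin n)}
    (hf : Continuous f) (hg : Continuous g) : Continuous (fun q => ee n (f q) (g q)) := by
  unfold ee; fun_prop

lemma ee_sub (n : ℕ) (x z ξ : EuclideanSpace ℝ (Fin n)) :
    ee n (x - z) ξ = ee n x ξ * Complex.exp (((-2 * Real.pi * inner ℝ z ξ : ℝ) : ℂ) * Complex.I) := by
  rw [ee, ee, ← Complex.exp_add, inner_sub_right, real_inner_comm ξ z]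
  congr 1; push_cast; ring

lemma ae_ne_zero_space (n : ℕ) (hn : 2 ≤ n) : ∀ᵐ ξ : EuclideanSpace ℝ (Fin n), ξ ≠ 0 := by
  have : Nonempty (Fin n) := ⟨⟨0, by omega⟩⟩
  have : Nontrivial (EuclideanSpace ℝ (Fin n)) := inferInstance
  exact Measure.ae_ne volume 0

/-- Fubini with the Gamma integral. -/
lemma gamma_fubini (n : ℕ) {α : ℝ} (hα : 0 < α) {V : EuclideanSpace ℝ (Fin n) → ℂ}
    (hV : AEStronglyMeasurable V volume) (hV0 : V 0 = 0)
    (hint : Integrable (fun ξ => ‖ξ‖ ^ (-(2 * α)) * ‖V ξ‖)) :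
    Integrable (fun q : ℝ × EuclideanSpace ℝ (Fin n) =>
      ((q.1 ^ (α - 1) * Real.exp (-(Real.pi * ‖q.2‖ ^ 2) * q.1) : ℝ) : ℂ) * V q.2)
      ((volume.restrict (Set.Ioi 0)).prod volume) ∧
    ∫ t in Set.Ioi (0 : ℝ), ∫ ξ, ((t ^ (α - 1) * Real.exp (-(Real.pi * ‖ξ‖ ^ 2) * t) : ℝ) : ℂ) * V ξ =
      ((Real.pi ^ (-α) * Real.Gamma α : ℝ) : ℂ) * ∫ ξ, ((‖ξ‖ ^ (-(2 * α)) : ℝ) : ℂ) * V ξ := by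
  have hval : ∀ ξ : EuclideanSpace ℝ (Fin n), ξ ≠ 0 → ∫ t in Set.Ioi (0 : ℝ), t ^ (α - 1) * Real.exp (-(Real.pi * ‖ξ‖ ^ 2) * t) = Real.pi ^ (-α) * Real.Gamma α * ‖ξ‖ ^ (-(2 * α)) := by
    intro ξ hξ
    have hξ' : 0 < ‖ξ‖ := norm_pos_iff.2 hξ
    rw [gamma_int hα (by positivity), Real.mul_rpow Real.pi_pos.le (by positivity), ← Real.rpow_natCast, ← Real.rpow_mul hξ'.le]
    have : ((2 : ℕ) : ℝ) * -α = -(2 * α) := by push_cast; ring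
    rw [this]; ring
  have h1 : Integrable (fun q : ℝ × EuclideanSpace ℝ (Fin n) =>
      ((q.1 ^ (α - 1) * Real.exp (-(Real.pi * ‖q.2‖ ^ 2) * q.1) : ℝ) : ℂ) * V q.2)
      ((volume.restrict (Set.Ioi 0)).prod volume) := by
    rw [integrable_prod_iff']
    · constructor
      · refine Eventually.of_forall fun ξ => ?_
        by_cases hξ : ξ = 0
        · simp [hξ, hV0]
        · have hξ' : 0 < ‖ξ‖ := norm_pos_iff.2 hξ
          have h2 : Integrable (fun t : ℝ => ((t ^ (α - 1) * Real.exp (-(Real.pi * ‖ξ‖ ^ 2) * t) : ℝ) : ℂ)) (volume.restrict (Set.Ioi 0)) :=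
            Integrable.ofReal (gamma_integrable hα (b := Real.pi * ‖ξ‖ ^ 2) (by positivity))
          exact h2.mul_const (V ξ)
      · refine (hint.const_mul (Real.pi ^ (-α) * Real.Gamma α)).congr (Eventually.of_forall fun ξ => ?_)
        simp only [norm_mul, Complex.norm_real]
        by_cases hξ : ξ = 0
        · simp [hξ, hV0]
        · rw [integral_mul_const, ← mul_assoc, ← hval ξ hξ]
          congr 1
          apply setIntegral_congr_fun measurableSet_Ioi
          intro t ht
          have ht : 0 < t := ht
          simp only
          rw [Real.norm_of_nonneg (by positivity), Real.norm_of_nonneg (by positivity)]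
    · apply AEStronglyMeasurable.mul
      · apply Measurable.aestronglyMeasurable
        fun_prop
      · exact hV.comp_snd
  refine ⟨h1, ?_⟩
  rw [integral_integral_swap h1, ← integral_const_mul]
  apply integral_congr_ae
  refine Eventually.of_forall fun ξ => ?_
  simp only
  by_cases hξ : ξ = 0
  · simp [hξ, hV0]
  · rw [integral_mul_const, integral_complex_ofReal, hval ξ hξ]
    push_cast
    ring

structure Good (n : ℕ) (u : EuclideanSpace ℝ (Fin n) → ℝ) (U : EuclideanSpace ℝ (Fin n) → ℂ) (M : ℝ) : Prop where
  cu : Continuous u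
  bd : ∀ x, |u x| ≤ M
  lip : ∀ x y, |u x - u y| ≤ M * ‖x - y‖
  cU : Continuous U
  i0 : Integrable U
  i1 : Integrable (fun ξ => ‖ξ‖ * ‖U ξ‖)
  inv : ∀ x, (u x : ℂ) = ∫ ξ, ee n x ξ * U ξ

lemma Good.is {n : ℕ} {u : EuclideanSpace ℝ (Fin n) → ℝ} {U : EuclideanSpace ℝ (Fin n) → ℂ} {M : ℝ}
    (g : Good n u U M) {s : ℝ} (hs : 0 < s) (hs1 : s < 1) : Integrable (fun ξ => ‖ξ‖ ^ s * ‖U ξ‖) := by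
  refine (g.i0.norm.add g.i1).mono' ?_ (Eventually.of_forall fun ξ => ?_)
  · have := g.cU
    apply Measurable.aestronglyMeasurable
    have := g.cU.measurable
    fun_prop
  · rw [Real.norm_of_nonneg (by positivity)]
    simp only [Pi.add_apply]
    have : ‖ξ‖ ^ s ≤ 1 + ‖ξ‖ := by
      rcases le_total ‖ξ‖ 1 with h | h
      · have := Real.rpow_le_one (norm_nonneg ξ) h hs.le
        linarith [norm_nonneg ξ]
      · have := Real.rpow_le_rpow_of_exponent_le h hs1.le
        rw [Real.rpow_one] at this
        linarith
    nlinarith [norm_nonneg (U ξ)]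

lemma Good.conv {n : ℕ} {u : EuclideanSpace ℝ (Fin n) → ℝ} {U : EuclideanSpace ℝ (Fin n) → ℂ} {M : ℝ}
    (g : Good n u U M) {t : ℝ} (ht : 0 < t) (x a : EuclideanSpace ℝ (Fin n)) :
    ((∫ z, (u x - u (x - z)) * inner ℝ a (Gk n t z) : ℝ) : ℂ) =
      2 * Real.pi * Complex.I * ∫ ξ, ((Real.exp (-(Real.pi * ‖ξ‖ ^ 2) * t) : ℝ) : ℂ) * (ee n x ξ * U ξ * ((inner ℝ a ξ : ℝ) : ℂ)) := by
  have hG := Gk_integrable n ht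
  have hGa : Integrable (fun z => inner ℝ a (Gk n t z)) := hG.const_inner a
  have hGac : Integrable (fun z => ((inner ℝ a (Gk n t z) : ℝ) : ℂ)) := hGa.ofReal
  have hGuc : Integrable (fun z => (u (x - z) : ℂ) * ((inner ℝ a (Gk n t z) : ℝ) : ℂ)) := by
    refine hGac.bdd_mul (c := M) ?_ (Eventually.of_forall fun z => ?_)
    · have := g.cu
      exact (by fun_prop : Continuous fun z => (u (x - z) : ℂ)).aestronglyMeasurable
    · rw [Complex.norm_real]; exact g.bd _
  have z0 : ∫ z, ((inner ℝ a (Gk n t z) : ℝ) : ℂ) = 0 := by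
    have := fourier_Gk n ht a 0
    simpa using this
  rw [← integral_complex_ofReal]
  have e : ∀ z, (((u x - u (x - z)) * inner ℝ a (Gk n t z) : ℝ) : ℂ) =
    (u x : ℂ) * ((inner ℝ a (Gk n t z) : ℝ) : ℂ) - (u (x - z) : ℂ) * ((inner ℝ a (Gk n t z) : ℝ) : ℂ) := by
    intro z; push_cast; ring
  have : ∫ z, (((u x - u (x - z)) * inner ℝ a (Gk n t z) : ℝ) : ℂ) = - ∫ z, (u (x - z) : ℂ) * ((inner ℝ a (Gk n t z) : ℝ) : ℂ) := by
    simp only [e]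
    rw [integral_sub (hGac.const_mul _) hGuc, integral_const_mul, z0]; ring
  refine Eq.trans this ?_
  have e2 : ∀ z, (u (x - z) : ℂ) * ((inner ℝ a (Gk n t z) : ℝ) : ℂ) =
      ∫ ξ, ee n (x - z) ξ * U ξ * ((inner ℝ a (Gk n t z) : ℝ) : ℂ) := by
    intro z
    rw [integral_mul_const, g.inv]
  rw [integral_congr_ae (Eventually.of_forall e2), integral_integral_swap]
  · rw [← integral_const_mul, ← integral_neg]
    apply integral_congr_ae
    refine Eventually.of_forall fun ξ => ?_
    simp only
    have e3 : ∀ z, ee n (x - z) ξ * U ξ * ((inner ℝ a (Gk n t z) : ℝ) : ℂ) =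
      ee n x ξ * U ξ * (Complex.exp (((-2 * Real.pi * inner ℝ z ξ : ℝ) : ℂ) * Complex.I) * ((inner ℝ a (Gk n t z) : ℝ) : ℂ)) := by
      intro z; rw [ee_sub]; ring
    rw [integral_congr_ae (Eventually.of_forall e3), integral_const_mul, fourier_Gk n ht]
    ring
  · refine (hGac.mul_prod g.i0).mono ?_ (Eventually.of_forall fun q => ?_)
    · apply Continuous.aestronglyMeasurable
      have h1 := g.cU
      have h2 := Gk_continuous n t
      have h3 : Continuous fun q : EuclideanSpace ℝ (Fin n) × EuclideanSpace ℝ (Fin n) => ee n (x - q.1) q.2 :=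
        ee_continuous n (continuous_const.sub continuous_fst) continuous_snd
      exact (h3.mul (h1.comp continuous_snd)).mul
        (Complex.continuous_ofReal.comp (continuous_const.inner (h2.comp continuous_fst)))
    · simp only [Function.uncurry, norm_mul, ee_norm, one_mul]
      rw [mul_comm]

lemma cns_const (n : ℕ) (hn : 2 ≤ n) {s : ℝ} (hs : 0 < s) (hs1 : s < 1) :
    cns n s * (2 * Real.pi * (Real.pi ^ (-((1 - s) / 2)) * Real.Gamma ((1 - s) / 2))) =
      (2 * Real.pi) ^ s * (2 * Real.pi ^ ((1 - n - s) / 2) * Real.Gamma ((n + s + 1) / 2)) := by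
  have hn' : (2 : ℝ) ≤ n := by exact_mod_cast hn
  have h1 : Real.Gamma (((n : ℝ) + s + 1) / 2) = ((n : ℝ) + s - 1) / 2 * Real.Gamma (((n : ℝ) + s - 1) / 2) := by
    rw [← Real.Gamma_add_one (by linarith : 0 < ((n : ℝ) + s - 1) / 2).ne']; congr 1; ring
  have hG : 0 < Real.Gamma ((1 - s) / 2) := Real.Gamma_pos_of_pos (by linarith)
  rw [cns, h1, Real.mul_rpow (by norm_num) Real.pi_pos.le]
  have e2 : (2 : ℝ) ^ (1 - s) * 2 ^ s = 2 := by
    rw [← Real.rpow_add (by norm_num)]; norm_num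
  have ep : Real.pi * Real.pi ^ (-((1 - s) / 2)) = Real.pi ^ s * Real.pi ^ ((1 - n - s) / 2) * Real.pi ^ ((n : ℝ) / 2) := by
    nth_rewrite 1 [← Real.rpow_one Real.pi]
    rw [← Real.rpow_add Real.pi_pos, ← Real.rpow_add Real.pi_pos, ← Real.rpow_add Real.pi_pos]; congr 1; ring
  have hp1 : 0 < Real.pi ^ ((n : ℝ) / 2) := by positivity
  have hp2 : 0 < (2 : ℝ) ^ (1 - s) := by positivity
  rw [div_mul_eq_mul_div, div_eq_iff (by positivity)]
  generalize Real.Gamma (((n : ℝ) + s - 1) / 2) = Γ₀ at *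
  generalize Real.Gamma ((1 - s) / 2) = Γ₁ at *
  generalize Real.pi ^ (-((1 - s) / 2)) = p₁ at *
  generalize Real.pi ^ ((1 - n - s) / 2) = p₂ at *
  generalize Real.pi ^ ((n : ℝ) / 2) = p₃ at *
  generalize Real.pi ^ s = p₄ at *
  generalize (2 : ℝ) ^ s = q₁ at *
  generalize (2 : ℝ) ^ (1 - s) = q₂ at *
  calc _ = ((n : ℝ) + s - 1) * Γ₀ * Γ₁ * 2 * (Real.pi * p₁) := by ring
    _ = ((n : ℝ) + s - 1) * Γ₀ * Γ₁ * (q₂ * q₁) * (p₄ * p₂ * p₃) := by rw [ep, e2]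
    _ = _ := by ring

lemma Good.prodInt {n : ℕ} {u : EuclideanSpace ℝ (Fin n) → ℝ} {U : EuclideanSpace ℝ (Fin n) → ℂ} {M : ℝ}
    (g : Good n u U M) {s : ℝ} (hs : 0 < s) (hs1 : s < 1) (x : EuclideanSpace ℝ (Fin n)) :
    Integrable (fun q : ℝ × EuclideanSpace ℝ (Fin n) =>
      (u x - u (x - q.2)) • (q.1 ^ ((1 - s) / 2 - 1) • Gk n q.1 q.2)) ((volume.restrict (Set.Ioi 0)).prod volume) := by
  have hM : 0 ≤ M := (abs_nonneg _).trans (g.bd 0)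
  have hm : Measurable (fun q : ℝ × EuclideanSpace ℝ (Fin n) =>
      (u x - u (x - q.2)) • (q.1 ^ ((1 - s) / 2 - 1) • Gk n q.1 q.2)) := by
    have h1 := Gk_measurable n
    have h2 := g.cu.measurable
    have h3 : Measurable (fun q : ℝ × EuclideanSpace ℝ (Fin n) => u (x - q.2)) :=
      h2.comp (measurable_const.sub measurable_snd)
    exact (measurable_const.sub h3).smul ((measurable_fst.pow_const _).smul h1)
  refine ⟨hm.aestronglyMeasurable, ?_⟩
  rw [hasFiniteIntegral_iff_enorm, lintegral_prod _ hm.enorm.aemeasurable]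
  set c := 2 * Real.pi * 2 ^ ((n : ℝ) / 2) with hc
  have hc0 : 0 ≤ c := by positivity
  refine (lint_mix (a := 1) (r₁ := (1 - s) / 2) (r₂ := s / 2) (c₁ := M * c) (c₂ := 2 * M * c) one_pos
    (by linarith) (by linarith) (by positivity) (by positivity) ?_ ?_).trans_lt ENNReal.ofReal_lt_top
  · intro t ht _
    calc _ ≤ ∫⁻ z, ENNReal.ofReal (M * t ^ ((1 - s) / 2 - 1)) * (‖z‖ₑ * ‖Gk n t z‖ₑ) := by
          apply lintegral_mono
          intro z
          simp only
          rw [enorm_smul, enorm_smul, ENNReal.ofReal_mul hM]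
          have : ‖u x - u (x - z)‖ₑ ≤ ENNReal.ofReal M * ‖z‖ₑ := by
            rw [← ofReal_norm, ← ofReal_norm, ← ENNReal.ofReal_mul hM]
            apply ENNReal.ofReal_le_ofReal
            simpa using g.lip x (x - z)
          refine (mul_le_mul_left this _).trans (le_of_eq ?_)
          rw [Real.enorm_of_nonneg (by positivity)]
          ring
      _ ≤ ENNReal.ofReal (M * t ^ ((1 - s) / 2 - 1)) * ENNReal.ofReal c := by
          rw [lintegral_const_mul' _ _ ENNReal.ofReal_ne_top]
          gcongr
          exact lintegral_norm_Gk_le n ht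
      _ = _ := by
          rw [← ENNReal.ofReal_mul (by positivity)]
          congr 1; ring
  · intro t ht'
    have ht : 0 < t := one_pos.trans ht'
    calc _ ≤ ∫⁻ z, ENNReal.ofReal (2 * M * t ^ ((1 - s) / 2 - 1)) * ‖Gk n t z‖ₑ := by
          apply lintegral_mono
          intro z
          simp only
          rw [enorm_smul, enorm_smul, ENNReal.ofReal_mul (by positivity)]
          have : ‖u x - u (x - z)‖ₑ ≤ ENNReal.ofReal (2 * M) := by
            rw [← ofReal_norm]
            apply ENNReal.ofReal_le_ofReal
            refine (norm_sub_le _ _).trans ?_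
            have h1 := g.bd x
            have h2 := g.bd (x - z)
            simp only [Real.norm_eq_abs]
            linarith
          refine (mul_le_mul_left this _).trans (le_of_eq ?_)
          rw [Real.enorm_of_nonneg (by positivity)]
          ring
      _ ≤ ENNReal.ofReal (2 * M * t ^ ((1 - s) / 2 - 1)) * ENNReal.ofReal (c * t ^ (-(1 / 2) : ℝ)) := by
          rw [lintegral_const_mul' _ _ ENNReal.ofReal_ne_top]
          gcongr
          exact lintegral_Gk_le n ht
      _ = _ := by
          rw [← ENNReal.ofReal_mul (by positivity)]
          congr 1
          have : t ^ (-(s / 2) - 1) = t ^ ((1 - s) / 2 - 1) * t ^ (-(1 / 2) : ℝ) := by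
            rw [← Real.rpow_add ht]; congr 1; ring
          rw [this]; ring

lemma Good.Vint {n : ℕ} {u : EuclideanSpace ℝ (Fin n) → ℝ} {U : EuclideanSpace ℝ (Fin n) → ℂ} {M : ℝ}
    (g : Good n u U M) {s : ℝ} (hs : 0 < s) (hs1 : s < 1) (x a : EuclideanSpace ℝ (Fin n)) :
    Integrable (fun ξ => ‖ξ‖ ^ (s - 1) * ‖ee n x ξ * U ξ * ((inner ℝ a ξ : ℝ) : ℂ)‖) := by
  refine ((g.is hs hs1).const_mul ‖a‖).mono' ?_ (Eventually.of_forall fun ξ => ?_)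
  · apply Measurable.aestronglyMeasurable
    have h1 := g.cU.measurable
    have h2 : Measurable fun ξ => ee n x ξ := (ee_continuous n continuous_const continuous_id).measurable
    have h3 : Measurable fun ξ : EuclideanSpace ℝ (Fin n) => ((inner ℝ a ξ : ℝ) : ℂ) :=
      (by fun_prop : Continuous fun ξ : EuclideanSpace ℝ (Fin n) => ((inner ℝ a ξ : ℝ) : ℂ)).measurable
    exact (measurable_norm.pow_const _).mul ((h2.mul h1).mul h3).norm
  · by_cases hξ : ξ = 0
    · simp [hξ]; positivity
    have hξ' : 0 < ‖ξ‖ := norm_pos_iff.2 hξ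
    rw [Real.norm_of_nonneg (by positivity)]
    simp only [norm_mul, ee_norm, one_mul, Complex.norm_real]
    have : ‖ξ‖ ^ s = ‖ξ‖ ^ (s - 1) * ‖ξ‖ := by
      rw [← Real.rpow_add_one hξ'.ne']; congr 1; ring
    rw [this]
    have h1 := norm_inner_le_norm (𝕜 := ℝ) a ξ
    calc _ ≤ ‖ξ‖ ^ (s - 1) * (‖U ξ‖ * (‖a‖ * ‖ξ‖)) := by gcongr
      _ = _ := by ring

lemma Good.riesz {n : ℕ} (hn : 2 ≤ n) {u : EuclideanSpace ℝ (Fin n) → ℝ} {U : EuclideanSpace ℝ (Fin n) → ℂ} {M : ℝ}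
    (g : Good n u U M) {s : ℝ} (hs : 0 < s) (hs1 : s < 1) (x a : EuclideanSpace ℝ (Fin n)) :
    ((inner ℝ a (rieszGrad n s u x) : ℝ) : ℂ) =
      (((2 * Real.pi) ^ s : ℝ) : ℂ) * Complex.I *
        ∫ ξ, ((‖ξ‖ ^ (s - 1) : ℝ) : ℂ) * (ee n x ξ * U ξ * ((inner ℝ a ξ : ℝ) : ℂ)) := by
  have hP := g.prodInt hs hs1 x
  obtain ⟨B, hB⟩ : ∃ B : ℝ, B = 2 * Real.pi ^ ((1 - n - s) / 2) * Real.Gamma ((n + s + 1) / 2) := ⟨_, rfl⟩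
  have hB0 : B ≠ 0 := by
    rw [hB]
    have : 0 < Real.Gamma (((n : ℝ) + s + 1) / 2) := Real.Gamma_pos_of_pos (by positivity)
    positivity
  obtain ⟨J, hJ⟩ : ∃ J, J = ∫ y, ((u x - u y) / ‖x - y‖ ^ ((n : ℝ) + s + 1)) • (x - y) := ⟨_, rfl⟩
  have h1 : B • J = ∫ t in Set.Ioi (0 : ℝ), ∫ z, (u x - u (x - z)) • (t ^ ((1 - s) / 2 - 1) • Gk n t z) := by
    rw [integral_integral_swap hP, hJ, ← integral_sub_left_eq_self _ volume x, ← integral_smul]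
    apply integral_congr_ae
    refine Eventually.of_forall fun z => ?_
    have hz : x - (x - z) = z := by abel
    simp only [hz]
    rw [integral_smul, int_Gk n hs, ← hB, smul_smul, smul_smul, smul_smul]
    congr 1
    ring
  have h2 : B * inner ℝ a J = ∫ t in Set.Ioi (0 : ℝ), t ^ ((1 - s) / 2 - 1) * ∫ z, (u x - u (x - z)) * inner ℝ a (Gk n t z) := by
    rw [← real_inner_smul_right, h1, ← integral_inner hP.integral_prod_left]
    apply integral_congr_ae
    filter_upwards [hP.prod_right_ae] with t ht
    rw [← integral_inner ht, ← integral_const_mul]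
    apply integral_congr_ae
    refine Eventually.of_forall fun z => ?_
    simp only [real_inner_smul_right]
    ring
  set V : EuclideanSpace ℝ (Fin n) → ℂ := fun ξ => ee n x ξ * U ξ * ((inner ℝ a ξ : ℝ) : ℂ) with hV
  have hVm : AEStronglyMeasurable V volume := by
    apply Continuous.aestronglyMeasurable
    exact ((ee_continuous n continuous_const continuous_id).mul g.cU).mul (by fun_prop)
  have hα : -(2 * ((1 - s) / 2)) = s - 1 := by ring
  have h3 := (gamma_fubini n (α := (1 - s) / 2) (by linarith) hVm (by simp [hV])
    (by rw [hα]; exact g.Vint hs hs1 x a)).2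
  rw [hα] at h3
  have h4 : ((B * inner ℝ a J : ℝ) : ℂ) = 2 * Real.pi * Complex.I *
      (((Real.pi ^ (-((1 - s) / 2)) * Real.Gamma ((1 - s) / 2) : ℝ) : ℂ) * ∫ ξ, ((‖ξ‖ ^ (s - 1) : ℝ) : ℂ) * V ξ) := by
    rw [h2, ← h3, ← integral_complex_ofReal, ← integral_const_mul]
    apply setIntegral_congr_fun measurableSet_Ioi
    intro t ht
    have ht : 0 < t := ht
    simp only
    rw [Complex.ofReal_mul, g.conv ht, mul_left_comm, ← integral_const_mul]
    congr 1
    apply integral_congr_ae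
    refine Eventually.of_forall fun ξ => ?_
    simp only [hV]
    push_cast
    ring
  have h5 : inner ℝ a (rieszGrad n s u x) = cns n s * inner ℝ a J := by
    rw [rieszGrad, ← hJ, real_inner_smul_right]
  have hBc : (B : ℂ) ≠ 0 := by exact_mod_cast hB0
  apply mul_left_cancel₀ hBc
  have hcns := congrArg (fun r : ℝ => (r : ℂ)) (cns_const n hn hs hs1)
  simp only [← hB] at hcns
  rw [Complex.ofReal_mul] at h4
  rw [h5, Complex.ofReal_mul]
  change (B : ℂ) * (_ * _) = (B : ℂ) * (_ * ∫ ξ, ((‖ξ‖ ^ (s - 1) : ℝ) : ℂ) * V ξ)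
  generalize (∫ ξ, ((‖ξ‖ ^ (s - 1) : ℝ) : ℂ) * V ξ) = W at *
  push_cast at hcns h4 ⊢
  linear_combination (cns n s : ℂ) * h4 + (Complex.I * W) * hcns

lemma Good.gradconv {n : ℕ} (hn : 2 ≤ n) {u : EuclideanSpace ℝ (Fin n) → ℝ} {U : EuclideanSpace ℝ (Fin n) → ℂ} {M : ℝ}
    (g : Good n u U M) {s : ℝ} (hs : 0 < s) (hs1 : s < 1) {t : ℝ} (ht : 0 < t) (x : EuclideanSpace ℝ (Fin n)) :
    Integrable (fun y => inner ℝ (Gk n t (x - y)) (rieszGrad n s u y)) ∧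
    ((∫ y, inner ℝ (Gk n t (x - y)) (rieszGrad n s u y) : ℝ) : ℂ) =
      (((2 * Real.pi) ^ (s + 1) : ℝ) : ℂ) *
        ∫ ξ, ((Real.exp (-(Real.pi * ‖ξ‖ ^ 2) * t) : ℝ) : ℂ) * (ee n x ξ * U ξ * ((‖ξ‖ ^ (s + 1) : ℝ) : ℂ)) := by
  have hG := (Gk_integrable n ht).norm
  have hGx : Integrable (fun y => ‖Gk n t (x - y)‖) := hG.comp_sub_left x
  have hGc := Gk_continuous n t
  have hH : Integrable (fun q : EuclideanSpace ℝ (Fin n) × EuclideanSpace ℝ (Fin n) =>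
      ((‖q.2‖ ^ (s - 1) : ℝ) : ℂ) * (ee n q.1 q.2 * U q.2 * ((inner ℝ (Gk n t (x - q.1)) q.2 : ℝ) : ℂ)))
      (volume.prod volume) := by
    refine (hGx.mul_prod (g.is hs hs1)).mono' ?_ (Eventually.of_forall fun q => ?_)
    · apply Measurable.aestronglyMeasurable
      have h3 : Continuous fun q : EuclideanSpace ℝ (Fin n) × EuclideanSpace ℝ (Fin n) => ee n q.1 q.2 :=
        ee_continuous n continuous_fst continuous_snd
      have h4 : Continuous fun q : EuclideanSpace ℝ (Fin n) × EuclideanSpace ℝ (Fin n) =>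
          ee n q.1 q.2 * U q.2 * ((inner ℝ (Gk n t (x - q.1)) q.2 : ℝ) : ℂ) :=
        (h3.mul (g.cU.comp continuous_snd)).mul
          (Complex.continuous_ofReal.comp ((hGc.comp (continuous_const.sub continuous_fst)).inner continuous_snd))
      exact (Complex.measurable_ofReal.comp (measurable_snd.norm.pow_const _)).mul h4.measurable
    · simp only [norm_mul, ee_norm, one_mul, Complex.norm_real]
      rcases eq_or_ne q.2 0 with h0 | h0
      · simp [h0]; positivity
      have hξ' : 0 < ‖q.2‖ := norm_pos_iff.2 h0
      have : ‖q.2‖ ^ s = ‖q.2‖ ^ (s - 1) * ‖q.2‖ := by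
        rw [← Real.rpow_add_one hξ'.ne']; congr 1; ring
      rw [this, Real.norm_of_nonneg (by positivity)]
      have h1 := norm_inner_le_norm (𝕜 := ℝ) (Gk n t (x - q.1)) q.2
      calc _ ≤ ‖q.2‖ ^ (s - 1) * (‖U q.2‖ * (‖Gk n t (x - q.1)‖ * ‖q.2‖)) := by gcongr
        _ = _ := by ring
  have hr : ∀ y, ((inner ℝ (Gk n t (x - y)) (rieszGrad n s u y) : ℝ) : ℂ) =
      (((2 * Real.pi) ^ s : ℝ) : ℂ) * Complex.I *
        ∫ ξ, ((‖ξ‖ ^ (s - 1) : ℝ) : ℂ) * (ee n y ξ * U ξ * ((inner ℝ (Gk n t (x - y)) ξ : ℝ) : ℂ)) :=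
    fun y => g.riesz hn hs hs1 y (Gk n t (x - y))
  constructor
  · have h1 := (hH.integral_prod_left.const_mul ((((2 * Real.pi) ^ s : ℝ) : ℂ) * Complex.I)).re
    refine h1.congr (Eventually.of_forall fun y => ?_)
    simp only
    rw [← hr y]
    simp
  · rw [← integral_complex_ofReal, integral_congr_ae (Eventually.of_forall hr), integral_const_mul,
      integral_integral_swap hH, ← integral_const_mul, ← integral_const_mul]
    apply integral_congr_ae
    refine Eventually.of_forall fun ξ => ?_
    simp only
    rw [← integral_sub_left_eq_self _ volume x]
    have e3 : ∀ z, ((‖ξ‖ ^ (s - 1) : ℝ) : ℂ) * (ee n (x - z) ξ * U ξ * ((inner ℝ (Gk n t (x - (x - z))) ξ : ℝ) : ℂ)) =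
      ((‖ξ‖ ^ (s - 1) : ℝ) : ℂ) * (ee n x ξ * U ξ) * (Complex.exp (((-2 * Real.pi * inner ℝ z ξ : ℝ) : ℂ) * Complex.I) * ((inner ℝ ξ (Gk n t z) : ℝ) : ℂ)) := by
      intro z
      have hz : x - (x - z) = z := by abel
      rw [ee_sub, hz, real_inner_comm ξ (Gk n t z)]; ring
    rw [integral_congr_ae (Eventually.of_forall e3), integral_const_mul, fourier_Gk n ht]
    have e4 : ‖ξ‖ ^ (s + 1) = ‖ξ‖ ^ (s - 1) * inner ℝ ξ ξ := by
      rcases eq_or_ne ξ 0 with h0 | h0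
      · rw [h0]; simp; exact Real.zero_rpow (by linarith)
      have hξ' : 0 < ‖ξ‖ := norm_pos_iff.2 h0
      rw [real_inner_self_eq_norm_sq, ← Real.rpow_natCast, ← Real.rpow_add hξ']
      congr 1; push_cast; ring
    rw [e4, Real.rpow_add_one (by positivity)]
    generalize Real.exp (-(Real.pi * ‖ξ‖ ^ 2) * t) = w
    push_cast
    linear_combination -(((2 * Real.pi : ℝ) ^ s : ℝ) : ℂ) * 2 * Real.pi * ((‖ξ‖ ^ (s - 1) : ℝ) : ℂ) * (ee n x ξ * U ξ) *
      ((inner ℝ ξ ξ : ℝ) : ℂ) * (w : ℂ) * Complex.I_sq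

lemma Good.repr {n : ℕ} (hn : 2 ≤ n) {u : EuclideanSpace ℝ (Fin n) → ℝ} {U : EuclideanSpace ℝ (Fin n) → ℂ} {M : ℝ}
    (g : Good n u U M) {s : ℝ} (hs : 0 < s) (hs1 : s < 1) (x : EuclideanSpace ℝ (Fin n)) :
    Integrable (fun t : ℝ => t ^ ((s - 1) / 2) * ∫ y, inner ℝ (Gk n t (x - y)) (rieszGrad n s u y))
      (volume.restrict (Set.Ioi 0)) ∧
    (2 * Real.pi) ^ (s + 1) * (Real.pi ^ (-((1 + s) / 2)) * Real.Gamma ((1 + s) / 2)) * u x =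
      ∫ t in Set.Ioi (0 : ℝ), t ^ ((s - 1) / 2) * ∫ y, inner ℝ (Gk n t (x - y)) (rieszGrad n s u y) := by
  obtain ⟨V, hV⟩ : ∃ V : EuclideanSpace ℝ (Fin n) → ℂ, V = fun ξ => ee n x ξ * U ξ * ((‖ξ‖ ^ (s + 1) : ℝ) : ℂ) := ⟨_, rfl⟩
  have hVm : AEStronglyMeasurable V volume := by
    rw [hV]
    apply Measurable.aestronglyMeasurable
    exact (((ee_continuous n continuous_const continuous_id).mul g.cU).measurable).mul
      (Complex.measurable_ofReal.comp (measurable_norm.pow_const _))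
  have hV0 : V 0 = 0 := by
    rw [hV]; simp; right; exact Real.zero_rpow (by linarith)
  have hα : -(2 * ((1 + s) / 2)) = -(s + 1) := by ring
  have hne := ae_ne_zero_space n hn
  have hint : Integrable (fun ξ => ‖ξ‖ ^ (-(2 * ((1 + s) / 2))) * ‖V ξ‖) := by
    refine g.i0.norm.congr ?_
    filter_upwards [hne] with ξ hξ
    have hξ' : 0 < ‖ξ‖ := norm_pos_iff.2 hξ
    rw [hα, hV]
    simp only [norm_mul, ee_norm, one_mul, Complex.norm_real]
    rw [Real.norm_of_nonneg (by positivity), Real.rpow_neg hξ'.le]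
    field_simp
  obtain ⟨h1, h2⟩ := gamma_fubini n (α := (1 + s) / 2) (by linarith) hVm hV0 hint
  have hα' : (1 + s) / 2 - 1 = (s - 1) / 2 := by ring
  rw [hα'] at h1 h2
  have h3 : ∫ ξ, ((‖ξ‖ ^ (-(2 * ((1 + s) / 2))) : ℝ) : ℂ) * V ξ = (u x : ℂ) := by
    rw [g.inv x]
    apply integral_congr_ae
    filter_upwards [hne] with ξ hξ
    have hξ' : 0 < ‖ξ‖ := norm_pos_iff.2 hξ
    have : ‖ξ‖ ^ (-(s + 1)) * ‖ξ‖ ^ (s + 1) = 1 := by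
      rw [← Real.rpow_add hξ']; simp
    have h' : ((‖ξ‖ ^ (-(s + 1)) : ℝ) : ℂ) * ((‖ξ‖ ^ (s + 1) : ℝ) : ℂ) = 1 := by
      rw [← Complex.ofReal_mul, this, Complex.ofReal_one]
    rw [hα, hV]
    simp only
    linear_combination (ee n x ξ * U ξ) * h'
  have key : ∀ t : ℝ, 0 < t →
      ((t ^ ((s - 1) / 2) * ∫ y, inner ℝ (Gk n t (x - y)) (rieszGrad n s u y) : ℝ) : ℂ) =
      (((2 * Real.pi) ^ (s + 1) : ℝ) : ℂ) *
        ∫ ξ, ((t ^ ((s - 1) / 2) * Real.exp (-(Real.pi * ‖ξ‖ ^ 2) * t) : ℝ) : ℂ) * V ξ := by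
    intro t ht
    rw [Complex.ofReal_mul, (g.gradconv hn hs hs1 ht x).2, mul_left_comm, ← integral_const_mul]
    congr 1
    apply integral_congr_ae
    refine Eventually.of_forall fun ξ => ?_
    simp only [hV]
    rw [Complex.ofReal_mul]; ring
  constructor
  · have h4 := (h1.integral_prod_left.const_mul (((2 * Real.pi) ^ (s + 1) : ℝ) : ℂ)).re
    refine h4.congr ?_
    filter_upwards [ae_restrict_mem measurableSet_Ioi] with t ht
    rw [← key t ht]
    simp
  · apply Complex.ofReal_injective
    rw [← integral_complex_ofReal, setIntegral_congr_fun measurableSet_Ioi (fun t ht => key t ht), integral_const_mul, h2, h3]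
    push_cast
    ring

lemma exists_good (n : ℕ) (u : EuclideanSpace ℝ (Fin n) → ℝ) (hu : ContDiff ℝ (⊤ : ℕ∞) u) (hc : HasCompactSupport u) :
    ∃ U M, Good n u U M := by
  have h1 : HasCompactSupport (fun x => (u x : ℂ)) := hc.comp_left (g := fun r : ℝ => (r : ℂ)) (by simp)
  have h2 : ContDiff ℝ (⊤ : ℕ∞) (fun x => (u x : ℂ)) := Complex.ofRealCLM.contDiff.comp hu
  obtain ⟨f, hf⟩ : ∃ f : SchwartzMap (EuclideanSpace ℝ (Fin n)) ℂ, ∀ x, f x = (u x : ℂ) :=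
    ⟨h1.toSchwartzMap h2, fun x => rfl⟩
  obtain ⟨C, hC⟩ := ContDiff.lipschitzWith_of_hasCompactSupport hc hu (by simp)
  obtain ⟨D, hD⟩ := hc.exists_bound_of_continuous hu.continuous
  refine ⟨FourierTransform.fourier f, max C D, hu.continuous, fun x => (hD x).trans (le_max_right _ _), ?_, ?_, ?_, ?_, ?_⟩
  · intro x y
    have := hC.dist_le_mul x y
    rw [Real.dist_eq, dist_eq_norm] at this
    exact this.trans (by gcongr; exact le_max_left _ _)
  · exact (FourierTransform.fourier f).continuous
  · exact (FourierTransform.fourier f).integrable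
  · simpa using (FourierTransform.fourier f).integrable_pow_mul volume 1
  · intro x
    have hi : Integrable (FourierTransform.fourier (f : EuclideanSpace ℝ (Fin n) → ℂ)) := by
      rw [← SchwartzMap.fourier_coe]; exact (FourierTransform.fourier f).integrable
    have h3 := congrFun (f.continuous.fourierInv_fourier_eq f.integrable hi) x
    rw [← hf, ← h3, Real.fourierInv_eq', SchwartzMap.fourier_coe]
    rfl

lemma rieszGrad_measurable (n : ℕ) (s : ℝ) {u : EuclideanSpace ℝ (Fin n) → ℝ} (hu : Continuous u) :
    Measurable (rieszGrad n s u) := by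
  have h : StronglyMeasurable (Function.uncurry fun x y : EuclideanSpace ℝ (Fin n) =>
      ((u x - u y) / ‖x - y‖ ^ ((n : ℝ) + s + 1)) • (x - y)) := by
    apply Measurable.stronglyMeasurable
    have h1 : Measurable fun q : EuclideanSpace ℝ (Fin n) × EuclideanSpace ℝ (Fin n) => u q.1 - u q.2 :=
      (hu.measurable.comp measurable_fst).sub (hu.measurable.comp measurable_snd)
    have h2 : Measurable fun q : EuclideanSpace ℝ (Fin n) × EuclideanSpace ℝ (Fin n) => q.1 - q.2 :=
      measurable_fst.sub measurable_snd
    exact (h1.div (h2.norm.pow_const _)).smul h2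
  exact (h.integral_prod_right (ν := volume)).measurable.const_smul (cns n s)

lemma kern_measurable (n : ℕ) (s : ℝ) (h : EuclideanSpace ℝ (Fin n)) :
    Measurable (fun q : ℝ × EuclideanSpace ℝ (Fin n) =>
      ENNReal.ofReal (q.1 ^ ((s - 1) / 2)) * ‖Gk n q.1 (q.2 + h) - Gk n q.1 q.2‖ₑ) := by
  have h1 := Gk_measurable n
  have h2 : Measurable fun q : ℝ × EuclideanSpace ℝ (Fin n) => Gk n q.1 (q.2 + h) :=
    h1.comp (measurable_fst.prodMk (measurable_snd.add_const h))
  exact (ENNReal.measurable_ofReal.comp (measurable_fst.pow_const _)).mul (h2.sub h1).enorm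

def kern (n : ℕ) (s : ℝ) (h z : EuclideanSpace ℝ (Fin n)) : ENNReal :=
  ∫⁻ t in Set.Ioi (0 : ℝ), ENNReal.ofReal (t ^ ((s - 1) / 2)) * ‖Gk n t (z + h) - Gk n t z‖ₑ

lemma kern_meas (n : ℕ) (s : ℝ) (h : EuclideanSpace ℝ (Fin n)) : Measurable (kern n s h) :=
  Measurable.lintegral_prod_left (f := fun t z => ENNReal.ofReal (t ^ ((s - 1) / 2)) * ‖Gk n t (z + h) - Gk n t z‖ₑ)
    (kern_measurable n s h)

lemma Good.pointwise {n : ℕ} (hn : 2 ≤ n) {u : EuclideanSpace ℝ (Fin n) → ℝ} {U : EuclideanSpace ℝ (Fin n) → ℂ} {M : ℝ}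
    (g : Good n u U M) {s : ℝ} (hs : 0 < s) (hs1 : s < 1) (h x : EuclideanSpace ℝ (Fin n)) :
    ENNReal.ofReal ((2 * Real.pi) ^ (s + 1) * (Real.pi ^ (-((1 + s) / 2)) * Real.Gamma ((1 + s) / 2))) * ‖u (x + h) - u x‖ₑ ≤
      ∫⁻ y, kern n s h (x - y) * ‖rieszGrad n s u y‖ₑ := by
  obtain ⟨i1, e1⟩ := g.repr hn hs hs1 (x + h)
  obtain ⟨i2, e2⟩ := g.repr hn hs hs1 x
  have hA : 0 ≤ (2 * Real.pi) ^ (s + 1) * (Real.pi ^ (-((1 + s) / 2)) * Real.Gamma ((1 + s) / 2)) := by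
    have : 0 < Real.Gamma ((1 + s) / 2) := Real.Gamma_pos_of_pos (by linarith)
    positivity
  obtain ⟨A, hAA⟩ : ∃ A, A = (2 * Real.pi) ^ (s + 1) * (Real.pi ^ (-((1 + s) / 2)) * Real.Gamma ((1 + s) / 2)) := ⟨_, rfl⟩
  rw [← hAA] at e1 e2 hA ⊢
  have e3 : A * (u (x + h) - u x) = ∫ t in Set.Ioi (0 : ℝ),
      (t ^ ((s - 1) / 2) * (∫ y, inner ℝ (Gk n t (x + h - y)) (rieszGrad n s u y)) -
      t ^ ((s - 1) / 2) * ∫ y, inner ℝ (Gk n t (x - y)) (rieszGrad n s u y)) := by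
    rw [integral_sub i1 i2, ← e1, ← e2]; ring
  have hD := rieszGrad_measurable n s g.cu
  calc _ = ‖A * (u (x + h) - u x)‖ₑ := by rw [enorm_mul, Real.enorm_of_nonneg hA]
    _ ≤ ∫⁻ t in Set.Ioi (0 : ℝ), ∫⁻ y, ENNReal.ofReal (t ^ ((s - 1) / 2)) * ‖Gk n t (x - y + h) - Gk n t (x - y)‖ₑ * ‖rieszGrad n s u y‖ₑ := by
        rw [e3]
        refine (enorm_integral_le_lintegral_enorm _).trans (setLIntegral_mono' measurableSet_Ioi fun t ht => ?_)
        have ht : 0 < t := ht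
        rw [← mul_sub, ← integral_sub (g.gradconv hn hs hs1 ht (x + h)).1 (g.gradconv hn hs hs1 ht x).1,
          ← integral_const_mul]
        refine (enorm_integral_le_lintegral_enorm _).trans (lintegral_mono fun y => ?_)
        simp only
        have hxy : x + h - y = x - y + h := by abel
        rw [← inner_sub_left, hxy, enorm_mul, Real.enorm_of_nonneg (by positivity), mul_assoc]
        gcongr
        rw [← ofReal_norm, ← ofReal_norm, ← ofReal_norm, ← ENNReal.ofReal_mul (norm_nonneg _)]
        exact ENNReal.ofReal_le_ofReal (norm_inner_le_norm _ _)
    _ = ∫⁻ y, ∫⁻ t in Set.Ioi (0 : ℝ), ENNReal.ofReal (t ^ ((s - 1) / 2)) * ‖Gk n t (x - y + h) - Gk n t (x - y)‖ₑ * ‖rieszGrad n s u y‖ₑ := by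
        apply lintegral_lintegral_swap
        apply Measurable.aemeasurable
        exact ((kern_measurable n s h).comp (measurable_fst.prodMk (measurable_const.sub measurable_snd))).mul
          (hD.comp measurable_snd).enorm
    _ = _ := by
        apply lintegral_congr
        intro y
        rw [lintegral_mul_const' _ _ enorm_ne_top]
        rfl

lemma gamma_lower : ∃ γ : ℝ, 0 < γ ∧ ∀ s : ℝ, 0 < s → s < 1 →
    γ ≤ (2 * Real.pi) ^ (s + 1) * (Real.pi ^ (-((1 + s) / 2)) * Real.Gamma ((1 + s) / 2)) := by
  have hcont : ContinuousOn Real.Gamma (Set.Icc (1 / 2) 1) := by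
    intro x hx
    refine (Real.differentiableAt_Gamma fun m => ?_).continuousAt.continuousWithinAt
    have h1 := hx.1
    have : (0 : ℝ) ≤ m := by positivity
    intro h; linarith
  obtain ⟨x₀, hx₀, hmin⟩ := isCompact_Icc.exists_isMinOn ⟨1, by norm_num⟩ hcont
  refine ⟨Real.Gamma x₀, Real.Gamma_pos_of_pos (by linarith [hx₀.1]), fun s hs hs1 => ?_⟩
  have h1 : Real.Gamma x₀ ≤ Real.Gamma ((1 + s) / 2) := hmin (by constructor <;> linarith)
  have hG : 0 < Real.Gamma ((1 + s) / 2) := Real.Gamma_pos_of_pos (by linarith)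
  have hpi := Real.pi_gt_three
  have h2 : 1 ≤ (2 * Real.pi) ^ (s + 1) * Real.pi ^ (-((1 + s) / 2)) := by
    rw [Real.mul_rpow (by norm_num) Real.pi_pos.le, mul_assoc, ← Real.rpow_add Real.pi_pos]
    have a := Real.one_le_rpow (x := 2) (z := s + 1) (by norm_num) (by linarith)
    have b := Real.one_le_rpow (x := Real.pi) (z := s + 1 + -((1 + s) / 2)) (by linarith) (by linarith)
    nlinarith
  nlinarith

/-- Estimation on translations for Bessel potential spaces:
`‖u(·+h) - u‖_p ≤ (C/(s(1-s))) |h|^s ‖D^s u‖_p`, with `C = C(n)` independent of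
`s ∈ (0,1)`, `p ∈ [1,∞)` and `h ∈ ℝⁿ`. -/
theorem translation_estimate_bessel
    (n : ℕ) (hn : 2 ≤ n) :
    ∃ C : ℝ, 0 < C ∧ ∀ s : ℝ, 0 < s → s < 1 → ∀ p : ℝ, 1 ≤ p →
      ∀ h : EuclideanSpace ℝ (Fin n), ∀ u : EuclideanSpace ℝ (Fin n) → ℝ,
        ContDiff ℝ (⊤ : ℕ∞) u → HasCompactSupport u →
        eLpNorm (fun x => u (x + h) - u x) (ENNReal.ofReal p) volume ≤
          ENNReal.ofReal (C / (s * (1 - s)) * ‖h‖ ^ s) *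
            eLpNorm (rieszGrad n s u) (ENNReal.ofReal p) volume := by
  obtain ⟨γ, hγ, hγ'⟩ := gamma_lower
  obtain ⟨K, hK⟩ : ∃ K : ℝ, K = 2 * (4 * Real.pi * 2 ^ ((n : ℝ) / 2) + 8 * Real.pi * Real.exp (Real.pi / 2) * 4 ^ ((n : ℝ) / 2)) := ⟨_, rfl⟩
  have hK0 : 0 < K := by rw [hK]; positivity
  refine ⟨K / γ, by positivity, fun s hs hs1 p hp h u hu hc => ?_⟩
  by_cases hh : h = 0
  · simp [hh]
  obtain ⟨U, M, g⟩ := exists_good n u hu hc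
  have hp0 : 0 < p := by linarith
  have hD := rieszGrad_measurable n s g.cu
  have hker : ∫⁻ z, kern n s h z ≤ ENNReal.ofReal (K / (s * (1 - s)) * ‖h‖ ^ s) := by
    rw [hK]
    refine le_trans (le_of_eq ?_) (lintegral_kernel_le n hs hs1 h hh)
    unfold kern
    rw [lintegral_lintegral_swap]
    exact ((kern_measurable n s h).comp measurable_swap).aemeasurable
  have hs1' : 0 < 1 - s := by linarith
  have hpt : ∀ x, ‖u (x + h) - u x‖ₑ ≤ ENNReal.ofReal γ⁻¹ * ∫⁻ y, kern n s h (x - y) * ‖rieszGrad n s u y‖ₑ := by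
    intro x
    have h1 : ENNReal.ofReal γ * ‖u (x + h) - u x‖ₑ ≤ ∫⁻ y, kern n s h (x - y) * ‖rieszGrad n s u y‖ₑ := by
      refine le_trans ?_ (g.pointwise hn hs hs1 h x)
      gcongr
      exact hγ' s hs hs1
    calc _ = ENNReal.ofReal γ⁻¹ * (ENNReal.ofReal γ * ‖u (x + h) - u x‖ₑ) := by
          rw [← mul_assoc, ← ENNReal.ofReal_mul (by positivity), inv_mul_cancel₀ hγ.ne', ENNReal.ofReal_one, one_mul]
      _ ≤ _ := by gcongr
  have hY := young n hp (kern_meas n s h) hD.enorm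
  have hpt0 : ENNReal.ofReal p ≠ 0 := by simpa using hp0
  rw [eLpNorm_eq_lintegral_rpow_enorm_toReal hpt0 ENNReal.ofReal_ne_top,
    eLpNorm_eq_lintegral_rpow_enorm_toReal hpt0 ENNReal.ofReal_ne_top, ENNReal.toReal_ofReal hp0.le]
  calc _ ≤ (∫⁻ x, (ENNReal.ofReal γ⁻¹ * ∫⁻ y, kern n s h (x - y) * ‖rieszGrad n s u y‖ₑ) ^ p) ^ (1 / p) := by
        gcongr with x
        exact hpt x
    _ = ENNReal.ofReal γ⁻¹ * (∫⁻ x, (∫⁻ y, kern n s h (x - y) * ‖rieszGrad n s u y‖ₑ) ^ p) ^ (1 / p) := by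
        simp only [ENNReal.mul_rpow_of_nonneg _ _ hp0.le]
        rw [lintegral_const_mul' _ _ (ENNReal.rpow_ne_top_of_nonneg hp0.le ENNReal.ofReal_ne_top),
          ENNReal.mul_rpow_of_nonneg _ _ (by positivity), ← ENNReal.rpow_mul, mul_one_div_cancel hp0.ne', ENNReal.rpow_one]
    _ ≤ ENNReal.ofReal γ⁻¹ * (ENNReal.ofReal (K / (s * (1 - s)) * ‖h‖ ^ s) * (∫⁻ y, ‖rieszGrad n s u y‖ₑ ^ p) ^ (1 / p)) := by
        gcongr
        refine hY.trans ?_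
        gcongr
    _ = _ := by
        rw [← mul_assoc, ← ENNReal.ofReal_mul (by positivity)]
        congr 2
        field_simp

end
end

section
/- (Rellich–Kondrachov theorem for Gagliardo spaces, subcritical case.) Let n ≥ 1, s ∈ (0,1), 1 ≤ p < ∞ with sp < n, let Ω ⊂ ℝⁿ be a measurable set of finite Lebesgue measure, and let 1 ≤ q < p_s^* = np/(n − sp). Then every sequence (u_k) of measurable functions u_k : ℝⁿ → ℝ with sup_k ( ‖u_k‖_{L^p(ℝⁿ)} + [u_k]_{W^{s,p}} ) < ∞ has a subsequence whose restrictions to Ω converge in L^q(Ω). -/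
open MeasureTheory Filter ENNReal

noncomputable section

/-- The Gagliardo seminorm
`[u]_{W^{s,p}} = (∫∫ |u x - u y|^p / |x - y|^{n+sp} dx dy)^{1/p}`, valued in `ℝ≥0∞`. -/
def gagliardoSeminorm (n : ℕ) (s p : ℝ) (u : EuclideanSpace ℝ (Fin n) → ℝ) : ℝ≥0∞ :=
  (∫⁻ x, ∫⁻ y, ENNReal.ofReal (|u x - u y| ^ p / ‖x - y‖ ^ ((n : ℝ) + s * p))) ^ (1 / p)

/-- index of the dyadic cube of side `2^{-j}` containing `x` -/
def cidx (n j : ℕ) (x : EuclideanSpace ℝ (Fin n)) : Fin n → ℤ := fun i => ⌊(2 : ℝ) ^ j * x i⌋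

/-- dyadic cube -/
def dcube (n j : ℕ) (m : Fin n → ℤ) : Set (EuclideanSpace ℝ (Fin n)) := {x | cidx n j x = m}

/-- average over a dyadic cube -/
def cavg (n j : ℕ) (u : EuclideanSpace ℝ (Fin n) → ℝ) (m : Fin n → ℤ) : ℝ :=
  ((2 : ℝ) ^ j) ^ n * ∫ y in dcube n j m, u y

/-- dyadic averaging operator -/
def Eavg (n j : ℕ) (u : EuclideanSpace ℝ (Fin n) → ℝ) (x : EuclideanSpace ℝ (Fin n)) : ℝ :=
  cavg n j u (cidx n j x)

lemma measurable_cidx (n j : ℕ) : Measurable (cidx n j) := by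
  unfold cidx
  refine measurable_pi_lambda _ fun i => ?_
  refine Int.measurable_floor.comp ?_
  fun_prop

lemma measurableSet_dcube (n j : ℕ) (m) : MeasurableSet (dcube n j m) :=
  measurable_cidx n j (MeasurableSet.singleton m)

lemma measurable_Eavg (n j : ℕ) (u) : Measurable (Eavg n j u) := by
  have : Measurable (cavg n j u) := Measurable.of_discrete
  exact this.comp (measurable_cidx n j)

lemma volume_dcube (n j : ℕ) (m : Fin n → ℤ) :
    volume (dcube n j m) = ENNReal.ofReal ((((2 : ℝ) ^ j) ^ n)⁻¹) := by
  have h2 : (0 : ℝ) < 2 ^ j := by positivity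
  have h : dcube n j m = (fun x : EuclideanSpace ℝ (Fin n) => x.ofLp) ⁻¹'
      (Set.univ.pi fun i => Set.Ico ((m i : ℝ) / 2 ^ j) (((m i : ℝ) + 1) / 2 ^ j)) := by
    ext x
    simp only [dcube, cidx, Set.mem_ofPred_eq, funext_iff, Set.mem_preimage, Set.mem_pi,
      Set.mem_univ, true_implies, Set.mem_Ico, Int.floor_eq_iff]
    refine forall_congr' fun i => ?_
    rw [div_le_iff₀ h2, lt_div_iff₀ h2, mul_comm]
  rw [h, (PiLp.volume_preserving_ofLp (Fin n)).measure_preimage, Real.volume_pi_Ico]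
  · have : ∀ i : Fin n, ((m i : ℝ) + 1) / 2 ^ j - (m i : ℝ) / 2 ^ j = (2 ^ j)⁻¹ := by
      intro i; field_simp; ring
    simp only [this, Finset.prod_const, Finset.card_univ, Fintype.card_fin]
    rw [← inv_pow ((2:ℝ) ^ j) n, ENNReal.ofReal_pow (by positivity)]
  · exact (MeasurableSet.univ_pi fun i => measurableSet_Ico).nullMeasurableSet

lemma dist_dcube (n j : ℕ) {x y : EuclideanSpace ℝ (Fin n)} (h : cidx n j y = cidx n j x) :
    ‖x - y‖ ≤ √n * (2 ^ j)⁻¹ := by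
  have h2 : (0 : ℝ) < 2 ^ j := by positivity
  rw [EuclideanSpace.norm_eq]
  have : √n * ((2:ℝ) ^ j)⁻¹ = √(n * ((2 ^ j)⁻¹) ^ 2) := by
    rw [Real.sqrt_mul (by positivity), Real.sqrt_sq (by positivity)]
  rw [this]
  apply Real.sqrt_le_sqrt
  have : ∀ i ∈ Finset.univ, ‖(x - y) i‖ ^ 2 ≤ (((2:ℝ) ^ j)⁻¹) ^ 2 := by
    intro i _
    have h1 := congrFun h i
    simp only [cidx] at h1
    have h3 := Int.abs_sub_lt_one_of_floor_eq_floor h1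
    rw [← mul_sub, abs_mul, abs_of_pos h2] at h3
    have : ‖(x - y) i‖ ≤ ((2:ℝ) ^ j)⁻¹ := by
      rw [Real.norm_eq_abs, PiLp.sub_apply, abs_sub_comm, ← one_div, le_div_iff₀ h2, mul_comm]
      exact h3.le
    gcongr
  refine (Finset.sum_le_sum this).trans ?_
  simp

lemma cidx_nested (n j : ℕ) {x y : EuclideanSpace ℝ (Fin n)}
    (h : cidx n (j+1) y = cidx n (j+1) x) : cidx n j y = cidx n j x := by
  have key : ∀ z : EuclideanSpace ℝ (Fin n), ∀ i, cidx n j z i = cidx n (j+1) z i / 2 := by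
    intro z i
    have := Int.floor_div_natCast ((2 : ℝ) ^ (j+1) * z i) 2
    simp only [cidx]
    rw [show (2:ℤ) = ((2:ℕ):ℤ) from rfl, ← this]
    congr 1
    push_cast
    ring
  funext i
  rw [key, key, h]

lemma enorm_integral_rpow_le {α : Type*} [MeasurableSpace α] (μ : Measure α)
    {p : ℝ} (hp : 1 ≤ p) {f : α → ℝ}
    (hf : AEStronglyMeasurable f μ) :
    ‖∫ x, f x ∂μ‖ₑ ^ p ≤ μ Set.univ ^ (p - 1) * ∫⁻ x, ‖f x‖ₑ ^ p ∂μ := by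
  have hp0 : 0 < p := by linarith
  have h1 := enorm_integral_le_lintegral_enorm (μ := μ) f
  rw [← eLpNorm_one_eq_lintegral_enorm] at h1
  have h2 := eLpNorm_le_eLpNorm_mul_rpow_measure_univ (μ := μ) (f := f) (p := 1)
    (q := ENNReal.ofReal p) (by simpa using hp) hf
  have h3 := ENNReal.rpow_le_rpow (h1.trans h2) hp0.le
  refine h3.trans (le_of_eq ?_)
  rw [ENNReal.mul_rpow_of_nonneg _ _ hp0.le, mul_comm,
    eLpNorm_eq_lintegral_rpow_enorm_toReal (by simpa using hp0) (by simp),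
    ENNReal.toReal_ofReal hp0.le, ← ENNReal.rpow_mul, ← ENNReal.rpow_mul]
  congr 2
  · simp; field_simp
  · rw [one_div_mul_cancel hp0.ne', ENNReal.rpow_one]

lemma cavg_sub (n j : ℕ) {p : ℝ} (hp : 1 ≤ p) {u : EuclideanSpace ℝ (Fin n) → ℝ}
    (hu : MemLp u (ENNReal.ofReal p) volume) (m) (a : ℝ) :
    a - cavg n j u m = ((2 : ℝ) ^ j) ^ n * ∫ y in dcube n j m, (a - u y) := by
  have hfin : IsFiniteMeasure (volume.restrict (dcube n j m)) :=
    ⟨by rw [Measure.restrict_apply_univ, volume_dcube]; exact ENNReal.ofReal_lt_top⟩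
  have hi : Integrable u (volume.restrict (dcube n j m)) :=
    (hu.restrict _).integrable (by simpa using hp)
  rw [integral_sub (integrable_const a) hi, cavg, mul_sub]
  congr 1
  rw [integral_const, measureReal_def, Measure.restrict_apply_univ, volume_dcube,
    ENNReal.toReal_ofReal (by positivity), smul_eq_mul]
  field_simp

lemma enorm_sub_cavg (n j : ℕ) {p : ℝ} (hp : 1 ≤ p) {u : EuclideanSpace ℝ (Fin n) → ℝ}
    (hu : MemLp u (ENNReal.ofReal p) volume) (m) (a : ℝ) :
    ‖a - cavg n j u m‖ₑ ^ p ≤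
      ENNReal.ofReal (((2 : ℝ) ^ j) ^ n) * ∫⁻ y in dcube n j m, ‖a - u y‖ₑ ^ p := by
  have hp0 : 0 < p := by linarith
  rw [cavg_sub n j hp hu, enorm_mul, ENNReal.mul_rpow_of_nonneg _ _ hp0.le]
  have h := enorm_integral_rpow_le (volume.restrict (dcube n j m)) hp
    (f := fun y => a - u y) (aestronglyMeasurable_const.sub hu.1.restrict)
  refine (mul_le_mul_right h _).trans (le_of_eq ?_)
  rw [← mul_assoc]
  congr 1
  rw [Measure.restrict_apply_univ, volume_dcube, Real.enorm_eq_ofReal (by positivity)]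
  have hb : (0:ℝ) < ((2 : ℝ) ^ j) ^ n := by positivity
  rw [ENNReal.ofReal_rpow_of_nonneg hb.le hp0.le, ENNReal.ofReal_rpow_of_pos (by positivity),
    ← ENNReal.ofReal_mul (by positivity)]
  congr 1
  rw [Real.inv_rpow hb.le, ← Real.rpow_neg hb.le, ← Real.rpow_add hb]
  simp

lemma enorm_cavg (n j : ℕ) {p : ℝ} (hp : 1 ≤ p) {u : EuclideanSpace ℝ (Fin n) → ℝ}
    (hu : MemLp u (ENNReal.ofReal p) volume) (m) :
    ‖cavg n j u m‖ₑ ^ p ≤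
      ENNReal.ofReal (((2 : ℝ) ^ j) ^ n) * ∫⁻ y, ‖u y‖ₑ ^ p := by
  have := enorm_sub_cavg n j hp hu m 0
  simp only [zero_sub, enorm_neg] at this
  exact this.trans (mul_le_mul_right (setLIntegral_le_lintegral _ _) _)

lemma lintegral_sub_Eavg (n j : ℕ) {s p : ℝ} (hs : 0 < s) (hp : 1 ≤ p)
    {u : EuclideanSpace ℝ (Fin n) → ℝ}
    (hu : MemLp u (ENNReal.ofReal p) volume) :
    ∫⁻ x, ‖u x - Eavg n j u x‖ₑ ^ p ≤
      ENNReal.ofReal (((2 : ℝ) ^ j) ^ n * (√n * (2 ^ j)⁻¹) ^ ((n:ℝ) + s * p)) *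
      ∫⁻ x, ∫⁻ y, ENNReal.ofReal (|u x - u y| ^ p / ‖x - y‖ ^ ((n : ℝ) + s * p)) := by
  have hp0 : 0 < p := by linarith
  have hsp : 0 < s * p := by positivity
  rw [← lintegral_const_mul' _ _ ENNReal.ofReal_ne_top]
  refine lintegral_mono fun x => ?_
  refine (enorm_sub_cavg n j hp hu _ _).trans ?_
  rw [ENNReal.ofReal_mul (by positivity), mul_assoc]
  refine mul_le_mul_right ?_ _
  rw [← lintegral_const_mul' _ _ ENNReal.ofReal_ne_top]
  refine le_trans ?_ (setLIntegral_le_lintegral (dcube n j (cidx n j x)) _)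
  refine setLIntegral_mono' (measurableSet_dcube _ _ _) fun y hy => ?_
  rw [← ENNReal.ofReal_mul (by positivity), ← ofReal_norm,
    ENNReal.ofReal_rpow_of_nonneg (norm_nonneg _) hp0.le]
  refine ENNReal.ofReal_le_ofReal ?_
  rw [Real.norm_eq_abs]
  have hd := dist_dcube n j hy
  rcases eq_or_ne x y with rfl | hxy
  · simp [hp0.ne']
  have h0 : 0 < ‖x - y‖ := norm_pos_iff.2 (sub_ne_zero.2 hxy)
  rw [mul_div_assoc', le_div_iff₀ (by positivity), mul_comm]
  gcongr

lemma eLpNorm_sub_Eavg (n j : ℕ) {s p : ℝ} (hs : 0 < s) (hp : 1 ≤ p)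
    {u : EuclideanSpace ℝ (Fin n) → ℝ}
    (hu : MemLp u (ENNReal.ofReal p) volume) :
    eLpNorm (u - Eavg n j u) (ENNReal.ofReal p) volume ≤
      ENNReal.ofReal (√n ^ (((n:ℝ) + s * p) / p)) * ENNReal.ofReal (2 ^ (-s)) ^ j *
        gagliardoSeminorm n s p u := by
  have hp0 : 0 < p := by linarith
  have hsp : 0 < s * p := by positivity
  rw [eLpNorm_eq_lintegral_rpow_enorm_toReal (by simpa using hp0) (by simp),
    ENNReal.toReal_ofReal hp0.le, gagliardoSeminorm]
  have h := ENNReal.rpow_le_rpow (lintegral_sub_Eavg n j hs hp hu) (one_div_nonneg.2 hp0.le)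
  refine h.trans (le_of_eq ?_)
  rw [ENNReal.mul_rpow_of_nonneg _ _ (one_div_nonneg.2 hp0.le)]
  congr 1
  rw [ENNReal.ofReal_rpow_of_nonneg (by positivity) (by positivity),
    ← ENNReal.ofReal_pow (by positivity), ← ENNReal.ofReal_mul (by positivity)]
  congr 1
  have h2 : (0:ℝ) < 2 ^ j := by positivity
  have e1 : ((2:ℝ) ^ (-s)) ^ j = ((2:ℝ) ^ j) ^ (-s) := by
    rw [← Real.rpow_natCast, ← Real.rpow_natCast, ← Real.rpow_mul (by norm_num),
      ← Real.rpow_mul (by norm_num), mul_comm]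
  have e2 : ((2:ℝ) ^ j) ^ n * (√n * (2 ^ j)⁻¹) ^ ((n:ℝ) + s * p)
      = √n ^ ((n:ℝ) + s * p) * ((2:ℝ) ^ j) ^ (-(s * p)) := by
    rw [Real.mul_rpow (by positivity) (by positivity), Real.inv_rpow h2.le, ← Real.rpow_neg h2.le,
      mul_left_comm, ← Real.rpow_natCast _ n, ← Real.rpow_add h2]
    congr 2; ring
  rw [e1, e2, Real.mul_rpow (by positivity) (by positivity), ← Real.rpow_mul (by positivity),
    ← Real.rpow_mul h2.le]
  congr 2
  · ring
  · field_simp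

lemma dyadic_bernstein (n j : ℕ) {p r : ℝ} (hp : 1 ≤ p) (hpr : p ≤ r)
    {g : EuclideanSpace ℝ (Fin n) → ℝ} (hg : Measurable g)
    (hc : ∀ x y, cidx n j y = cidx n j x → g y = g x) :
    eLpNorm g (ENNReal.ofReal r) volume ≤
      ENNReal.ofReal (2 ^ (n * (1 / p - 1 / r))) ^ j * eLpNorm g (ENNReal.ofReal p) volume := by
  have hp0 : 0 < p := by linarith
  have hr0 : 0 < r := by linarith
  rw [eLpNorm_eq_lintegral_rpow_enorm_toReal (p := ENNReal.ofReal p) (by simpa using hp0) (by simp),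
    eLpNorm_eq_lintegral_rpow_enorm_toReal (p := ENNReal.ofReal r) (by simpa using hr0) (by simp),
    ENNReal.toReal_ofReal hp0.le, ENNReal.toReal_ofReal hr0.le]
  set I := ∫⁻ x, ‖g x‖ₑ ^ p with hI
  set W := ENNReal.ofReal (((2:ℝ) ^ j) ^ n) with hW
  have hb : (0:ℝ) < ((2:ℝ) ^ j) ^ n := by positivity
  have ha : 0 ≤ (r - p) / p := div_nonneg (by linarith) hp0.le
  have hpt : ∀ x, ‖g x‖ₑ ^ p ≤ W * I := by
    intro x
    have h1 : ∫⁻ y in dcube n j (cidx n j x), ‖g y‖ₑ ^ p =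
        ‖g x‖ₑ ^ p * volume (dcube n j (cidx n j x)) := by
      rw [← setLIntegral_const]
      refine setLIntegral_congr_fun (measurableSet_dcube _ _ _) fun y hy => ?_
      rw [hc x y hy]
    have h2 : ‖g x‖ₑ ^ p * volume (dcube n j (cidx n j x)) ≤ I :=
      h1 ▸ setLIntegral_le_lintegral _ _
    rw [volume_dcube] at h2
    calc ‖g x‖ₑ ^ p = W * (‖g x‖ₑ ^ p * ENNReal.ofReal (((2:ℝ) ^ j) ^ n)⁻¹) := by
          rw [mul_left_comm, hW, ← ENNReal.ofReal_mul hb.le, mul_inv_cancel₀ hb.ne']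
          simp
      _ ≤ W * I := mul_le_mul_right h2 _
  have hint : ∫⁻ x, ‖g x‖ₑ ^ r ≤ W ^ ((r - p) / p) * I ^ (r / p) := by
    calc ∫⁻ x, ‖g x‖ₑ ^ r ≤ ∫⁻ x, (W * I) ^ ((r - p) / p) * ‖g x‖ₑ ^ p := by
          refine lintegral_mono fun x => ?_
          have : ‖g x‖ₑ ^ r = (‖g x‖ₑ ^ p) ^ ((r - p) / p) * ‖g x‖ₑ ^ p := by
            rw [← ENNReal.rpow_mul, ← ENNReal.rpow_add_of_nonneg _ _ (by positivity) hp0.le]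
            congr 1; field_simp; ring
          simp only
          rw [this]
          exact mul_le_mul_left (ENNReal.rpow_le_rpow (hpt x) ha) _
      _ = (W * I) ^ ((r - p) / p) * I := by
          rw [lintegral_const_mul _ (by fun_prop)]
      _ = W ^ ((r - p) / p) * I ^ (r / p) := by
          rw [ENNReal.mul_rpow_of_nonneg _ _ ha, mul_assoc]
          congr 1
          nth_rw 2 [← ENNReal.rpow_one I]
          rw [← ENNReal.rpow_add_of_nonneg _ _ ha zero_le_one]
          congr 1; field_simp; ring
  refine (ENNReal.rpow_le_rpow hint (one_div_nonneg.2 hr0.le)).trans (le_of_eq ?_)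
  rw [ENNReal.mul_rpow_of_nonneg _ _ (one_div_nonneg.2 hr0.le), ← ENNReal.rpow_mul,
    ← ENNReal.rpow_mul]
  congr 1
  · rw [hW, ENNReal.ofReal_rpow_of_pos hb, ← ENNReal.ofReal_pow (by positivity)]
    congr 1
    simp only [← Real.rpow_natCast]
    rw [← Real.rpow_mul (by norm_num), ← Real.rpow_mul (by norm_num),
      ← Real.rpow_mul (by norm_num)]
    congr 1; field_simp
  · congr 1; field_simp

lemma eLpNorm_Eavg_succ (n j : ℕ) {s p r : ℝ} (hs : 0 < s) (hp : 1 ≤ p) (hpr : p ≤ r)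
    {u : EuclideanSpace ℝ (Fin n) → ℝ}
    (hu : MemLp u (ENNReal.ofReal p) volume) :
    eLpNorm (Eavg n (j+1) u - Eavg n j u) (ENNReal.ofReal r) volume ≤
      ENNReal.ofReal (2 ^ (n * (1 / p - 1 / r))) *
      (2 * ENNReal.ofReal (√n ^ (((n:ℝ) + s * p) / p)) * gagliardoSeminorm n s p u) *
      (ENNReal.ofReal (2 ^ (n * (1 / p - 1 / r))) * ENNReal.ofReal (2 ^ (-s))) ^ j := by
  set b := ENNReal.ofReal (2 ^ (n * (1 / p - 1 / r)))
  set a := ENNReal.ofReal (2 ^ (-s)) with ha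
  set C := ENNReal.ofReal (√n ^ (((n:ℝ) + s * p) / p))
  have ha1 : a ≤ 1 := by
    rw [ha, ENNReal.ofReal_le_one]
    exact Real.rpow_le_one_of_one_le_of_nonpos (by norm_num) (by linarith)
  have hB := dyadic_bernstein n (j+1) hp hpr
    ((measurable_Eavg n (j+1) u).sub (measurable_Eavg n j u)) (by
      intro x y h
      simp only [Pi.sub_apply, Eavg, h, cidx_nested n j h])
  have hd : Eavg n (j+1) u - Eavg n j u = (u - Eavg n j u) - (u - Eavg n (j+1) u) := by
    abel
  have hm : ∀ j, AEStronglyMeasurable (u - Eavg n j u) volume := fun j =>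
    hu.1.sub (measurable_Eavg n j u).aestronglyMeasurable
  have hs' := eLpNorm_sub_le (hm j) (hm (j+1)) (p := ENNReal.ofReal p) (by simpa using hp)
  rw [← hd] at hs'
  have h0 := eLpNorm_sub_Eavg n j hs hp hu
  have h1 := eLpNorm_sub_Eavg n (j+1) hs hp hu
  have h1' : eLpNorm (u - Eavg n (j+1) u) (ENNReal.ofReal p) volume ≤
      C * a ^ j * gagliardoSeminorm n s p u := by
    refine h1.trans ?_
    have : a ^ (j+1) ≤ a ^ j := pow_le_pow_right_of_le_one' ha1 (Nat.le_succ j)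
    gcongr
  refine hB.trans ?_
  refine (mul_le_mul_right (hs'.trans (add_le_add h0 h1')) _).trans (le_of_eq ?_)
  ring

lemma tail_bound (n : ℕ) {s p r : ℝ} (hs : 0 < s) (hp : 1 ≤ p) (hpr : p ≤ r)
    (hr : n * (1 / p - 1 / r) < s) :
    ∃ C ρ : ℝ≥0∞, C < ⊤ ∧ ρ < 1 ∧ ∀ u : EuclideanSpace ℝ (Fin n) → ℝ,
      MemLp u (ENNReal.ofReal p) volume → gagliardoSeminorm n s p u < ⊤ → ∀ J,
      eLpNorm (u - Eavg n J u) (ENNReal.ofReal r) volume ≤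
        C * gagliardoSeminorm n s p u * ρ ^ J := by
  set b := ENNReal.ofReal (2 ^ (n * (1 / p - 1 / r))) with hb
  set a := ENNReal.ofReal (2 ^ (-s)) with ha
  set C := ENNReal.ofReal (√n ^ (((n:ℝ) + s * p) / p))
  have hρ : b * a < 1 := by
    rw [hb, ha, ← ENNReal.ofReal_mul (by positivity), ← Real.rpow_add (by norm_num),
      ENNReal.ofReal_lt_one]
    exact Real.rpow_lt_one_of_one_lt_of_neg (by norm_num) (by linarith)
  have ha1 : a < 1 := by
    rw [ha, ENNReal.ofReal_lt_one]
    exact Real.rpow_lt_one_of_one_lt_of_neg (by norm_num) (by linarith)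
  refine ⟨b * (2 * C) * (1 - b * a)⁻¹, b * a, ?_, hρ, ?_⟩
  · refine ENNReal.mul_lt_top (ENNReal.mul_lt_top ENNReal.ofReal_lt_top
      (ENNReal.mul_lt_top (by simp) ENNReal.ofReal_lt_top)) ?_
    rw [ENNReal.inv_lt_top]
    exact tsub_pos_of_lt hρ
  intro u hu hG J
  set G := gagliardoSeminorm n s p u with hGdef
  have hr1 : (1:ℝ≥0∞) ≤ ENNReal.ofReal r := by simpa using hp.trans hpr
  have hme : ∀ j, AEStronglyMeasurable (Eavg n j u) volume := fun j =>
    (measurable_Eavg n j u).aestronglyMeasurable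
  -- telescoping
  have htel : ∀ m, eLpNorm (Eavg n (J + m) u - Eavg n J u) (ENNReal.ofReal r) volume ≤
      ∑ i ∈ Finset.range m, b * (2 * C * G) * (b * a) ^ (J + i) := by
    intro m
    induction m with
    | zero => simp
    | succ m ih =>
      rw [Finset.sum_range_succ]
      have e : Eavg n (J + (m + 1)) u - Eavg n J u =
          (Eavg n (J + m) u - Eavg n J u) + (Eavg n (J + m + 1) u - Eavg n (J + m) u) := by
        rw [← add_assoc]; abel
      rw [e]
      refine (eLpNorm_add_le ((hme _).sub (hme _)) ((hme _).sub (hme _)) hr1).trans ?_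
      exact add_le_add ih (eLpNorm_Eavg_succ n (J + m) hs hp hpr hu)
  have htel2 : ∀ m, eLpNorm (Eavg n (J + m) u - Eavg n J u) (ENNReal.ofReal r) volume ≤
      b * (2 * C) * (1 - b * a)⁻¹ * G * (b * a) ^ J := by
    intro m
    refine (htel m).trans ?_
    have : ∑ i ∈ Finset.range m, b * (2 * C * G) * (b * a) ^ (J + i) =
        b * (2 * C * G) * (b * a) ^ J * ∑ i ∈ Finset.range m, (b * a) ^ i := by
      rw [Finset.mul_sum]
      refine Finset.sum_congr rfl fun i _ => ?_
      rw [pow_add, mul_assoc (b * (2 * C * G))]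
    rw [this]
    refine (mul_le_mul_right (ENNReal.sum_le_tsum (Finset.range m)) _).trans (le_of_eq ?_)
    rw [ENNReal.tsum_geometric]
    ring
  -- a.e. convergence along a subsequence
  have hlim : Tendsto (fun m => eLpNorm (Eavg n (J + m) u - u) (ENNReal.ofReal p) volume) atTop
      (nhds 0) := by
    have h1 : Tendsto (fun m => C * a ^ (J + m) * G) atTop (nhds (C * 0 * G)) := by
      have h2 : Tendsto (fun m => a ^ (J + m)) atTop (nhds 0) := by
        have := ENNReal.tendsto_pow_atTop_nhds_zero_of_lt_one ha1
        exact this.comp (tendsto_add_atTop_nat J |>.congr fun m => by ring)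
      exact ENNReal.Tendsto.mul_const (ENNReal.Tendsto.const_mul h2 (Or.inr ENNReal.ofReal_ne_top))
        (Or.inr hG.ne)
    rw [mul_zero, zero_mul] at h1
    refine tendsto_of_tendsto_of_tendsto_of_le_of_le tendsto_const_nhds h1 (fun _ => zero_le) ?_
    intro m
    simp only
    rw [eLpNorm_sub_comm]
    exact eLpNorm_sub_Eavg n (J + m) hs hp hu
  obtain ⟨ns, -, hns⟩ := (tendstoInMeasure_of_tendsto_eLpNorm (p := ENNReal.ofReal p)
    (by simp; linarith) (fun m => hme (J + m)) hu.1 hlim).exists_seq_tendsto_ae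
  have hF := Lp.eLpNorm_lim_le_liminf_eLpNorm (p := ENNReal.ofReal r) (μ := volume)
    (f := fun i => Eavg n (J + ns i) u - Eavg n J u)
    (fun i => (hme _).sub (hme _)) (u - Eavg n J u) (by
      filter_upwards [hns] with x hx
      simp only [Pi.sub_apply]
      exact hx.sub_const _)
  refine hF.trans ?_
  refine liminf_le_of_le (by isBoundedDefault) ?_
  intro c hc
  obtain ⟨i, hi⟩ := hc.exists
  exact hi.trans (htel2 _)

lemma tendsto_Eavg (n J : ℕ) {r : ℝ} (hr : 1 ≤ r) (Ω : Set (EuclideanSpace ℝ (Fin n)))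
    (hΩfin : volume Ω < ⊤) (v : ℕ → EuclideanSpace ℝ (Fin n) → ℝ) (a : (Fin n → ℤ) → ℝ) (M : ℝ)
    (hM : ∀ k m, |cavg n J (v k) m| ≤ M) (haM : ∀ m, |a m| ≤ M)
    (hlim : ∀ m, Tendsto (fun k => cavg n J (v k) m) atTop (nhds (a m))) :
    Tendsto (fun k => eLpNorm (Eavg n J (v k) - fun x => a (cidx n J x)) (ENNReal.ofReal r)
      (volume.restrict Ω)) atTop (nhds 0) := by
  have hr0 : 0 < r := by linarith
  have hma : Measurable (fun x => a (cidx n J x)) :=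
    (Measurable.of_discrete (f := a)).comp (measurable_cidx n J)
  simp only [eLpNorm_eq_lintegral_rpow_enorm_toReal (p := ENNReal.ofReal r) (by simpa using hr0)
    (by simp), ENNReal.toReal_ofReal hr0.le]
  have h := tendsto_lintegral_of_dominated_convergence (μ := volume.restrict Ω)
    (F := fun k x => ‖(Eavg n J (v k) - fun x => a (cidx n J x)) x‖ₑ ^ r) (f := fun _ => 0)
    (fun _ => ENNReal.ofReal (2 * M) ^ r)
    (fun k => ((measurable_Eavg n J (v k)).sub hma).enorm.pow_const r)
    (fun k => ae_of_all _ fun x => by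
      simp only [Pi.sub_apply]
      refine ENNReal.rpow_le_rpow ?_ hr0.le
      rw [← ofReal_norm, Real.norm_eq_abs]
      refine ENNReal.ofReal_le_ofReal ((abs_sub _ _).trans ?_)
      have := hM k (cidx n J x)
      have := haM (cidx n J x)
      simp only [Eavg]
      linarith)
    (by
      rw [lintegral_const, Measure.restrict_apply_univ]
      exact (ENNReal.mul_lt_top (ENNReal.rpow_lt_top_of_nonneg hr0.le ENNReal.ofReal_ne_top)
        hΩfin).ne)
    (ae_of_all _ fun x => by
      have h1 : Tendsto (fun k => ‖(Eavg n J (v k) - fun x => a (cidx n J x)) x‖ₑ) atTop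
          (nhds 0) := by
        have h2 := (hlim (cidx n J x)).sub_const (a (cidx n J x))
        rw [sub_self] at h2
        simpa [Eavg] using h2.enorm
      have h3 := h1.ennrpow_const r
      rwa [ENNReal.zero_rpow_of_pos hr0] at h3)
  have h4 := h.ennrpow_const (1 / r)
  simp only [lintegral_zero] at h4
  rwa [ENNReal.zero_rpow_of_pos (by positivity)] at h4

lemma exists_lim {α : Type*} [MeasurableSpace α] (μ : Measure α) {r : ℝ≥0∞} (hr : 1 ≤ r)
    (v : ℕ → α → ℝ) (hv : ∀ k, AEStronglyMeasurable (v k) μ)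
    (g : ℕ → ℕ → α → ℝ) (hg : ∀ J k, AEStronglyMeasurable (g J k) μ)
    (G : ℕ → α → ℝ) (hG : ∀ J, AEStronglyMeasurable (G J) μ)
    (hmem : ∀ k, MemLp (v k) r μ)
    (t : ℕ → ℝ≥0∞) (ht : Tendsto t atTop (nhds 0))
    (h1 : ∀ J k, eLpNorm (v k - g J k) r μ ≤ t J)
    (h2 : ∀ J, Tendsto (fun k => eLpNorm (g J k - G J) r μ) atTop (nhds 0)) :
    ∃ f : α → ℝ, AEStronglyMeasurable f μ ∧
      Tendsto (fun k => eLpNorm (v k - f) r μ) atTop (nhds 0) := by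
  haveI : Fact (1 ≤ r) := ⟨hr⟩
  have hC : CauchySeq (fun k => (hmem k).toLp (v k)) := by
    rw [EMetric.cauchySeq_iff]
    intro ε hε
    have hε4 : 0 < ε / 4 := ENNReal.div_pos hε.ne' (by simp)
    obtain ⟨J, hJ⟩ := (ht.eventually (gt_mem_nhds hε4)).exists
    obtain ⟨N, hN⟩ := eventually_atTop.1 ((h2 J).eventually (gt_mem_nhds hε4))
    refine ⟨N, fun k hk l hl => ?_⟩
    rw [Lp.edist_toLp_toLp]
    have key : ∀ k ≥ N, eLpNorm (v k - G J) r μ < ε / 4 + ε / 4 := by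
      intro k hk
      have e : v k - G J = (v k - g J k) + (g J k - G J) := by abel
      rw [e]
      exact (eLpNorm_add_le ((hv _).sub (hg _ _)) ((hg _ _).sub (hG _)) hr).trans_lt
        (ENNReal.add_lt_add ((h1 J k).trans_lt hJ) (hN k hk))
    have e : v k - v l = (v k - G J) - (v l - G J) := by abel
    rw [e]
    refine (eLpNorm_sub_le ((hv _).sub (hG _)) ((hv _).sub (hG _)) hr).trans_lt ?_
    refine (ENNReal.add_lt_add (key k hk) (key l hl)).trans_le (le_of_eq ?_)
    have : ε / 4 + ε / 4 + (ε / 4 + ε / 4) = 4 * (ε / 4) := by ring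
    rw [this, ENNReal.mul_div_cancel (by simp) (by simp)]
  obtain ⟨f, hf⟩ := cauchySeq_tendsto_of_complete hC
  refine ⟨f, Lp.aestronglyMeasurable f, ?_⟩
  have := (Lp.tendsto_Lp_iff_tendsto_eLpNorm' _ _).1 hf
  refine this.congr fun k => eLpNorm_congr_ae ?_
  exact (MemLp.coeFn_toLp (hmem k)).sub (ae_eq_refl _)

/-- Rellich–Kondrachov theorem for Gagliardo spaces, subcritical case `sp < n`:
`W^{s,p}(ℝⁿ) ↪↪ L^q(Ω)` for `1 ≤ q < p_s^* = np/(n-sp)` and `Ω` of finite measure. -/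
theorem gagliardo_compact_embedding_subcritical
    (n : ℕ) (hn : 1 ≤ n) (s p : ℝ) (hs0 : 0 < s) (hs1 : s < 1)
    (hp : 1 ≤ p) (hsp : s * p < n)
    (Ω : Set (EuclideanSpace ℝ (Fin n))) (hΩmeas : MeasurableSet Ω)
    (hΩfin : volume Ω < ⊤)
    (q : ℝ) (hq : 1 ≤ q) (hq' : q < n * p / (n - s * p))
    (u : ℕ → EuclideanSpace ℝ (Fin n) → ℝ)
    (humeas : ∀ k, Measurable (u k))
    (hbdd : (⨆ k, eLpNorm (u k) (ENNReal.ofReal p) volume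
        + gagliardoSeminorm n s p (u k)) < ⊤) :
    ∃ (φ : ℕ → ℕ) (f : EuclideanSpace ℝ (Fin n) → ℝ), StrictMono φ ∧
      Tendsto (fun j => eLpNorm (fun x => u (φ j) x - f x) (ENNReal.ofReal q)
        (volume.restrict Ω)) atTop (nhds 0) := by
  have hp0 : 0 < p := by linarith
  have hn0 : (0:ℝ) < n := by exact_mod_cast hn
  set K := ⨆ k, eLpNorm (u k) (ENNReal.ofReal p) volume + gagliardoSeminorm n s p (u k) with hK
  have hKk : ∀ k, eLpNorm (u k) (ENNReal.ofReal p) volume + gagliardoSeminorm n s p (u k) ≤ K :=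
    fun k => le_iSup (fun k => eLpNorm (u k) (ENNReal.ofReal p) volume
      + gagliardoSeminorm n s p (u k)) k
  have hK1 : ∀ k, eLpNorm (u k) (ENNReal.ofReal p) volume ≤ K := fun k =>
    le_self_add.trans (hKk k)
  have hK2 : ∀ k, gagliardoSeminorm n s p (u k) ≤ K := fun k =>
    le_add_self.trans (hKk k)
  have hmem : ∀ k, MemLp (u k) (ENNReal.ofReal p) volume := fun k =>
    ⟨(humeas k).aestronglyMeasurable, (hK1 k).trans_lt hbdd⟩
  set r := max p q with hrdef
  have hpr : p ≤ r := le_max_left _ _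
  have hqr : q ≤ r := le_max_right _ _
  have hr1 : 1 ≤ r := hp.trans hpr
  have hr0 : 0 < r := by linarith
  have hd : (0:ℝ) < n - s * p := by linarith
  have hrlt : r < n * p / (n - s * p) := by
    refine max_lt ?_ hq'
    rw [lt_div_iff₀ hd]
    nlinarith [mul_pos hs0 hp0, mul_pos (mul_pos hs0 hp0) hp0]
  have hrs : n * (1 / p - 1 / r) < s := by
    rw [lt_div_iff₀ hd] at hrlt
    have : n * (1 / p - 1 / r) = (n * r - n * p) / (p * r) := by field_simp
    rw [this, div_lt_iff₀ (by positivity)]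
    nlinarith
  obtain ⟨C, ρ, hC, hρ, htail⟩ := tail_bound n hs0 hp hpr hrs
  -- bounds on the coefficients
  let B : ℕ → ℝ≥0∞ := fun j => (ENNReal.ofReal (((2 : ℝ) ^ j) ^ n) * K ^ p) ^ (1 / p)
  have hBtop : ∀ j, B j < ⊤ := fun j =>
    ENNReal.rpow_lt_top_of_nonneg (by positivity) (ENNReal.mul_lt_top ENNReal.ofReal_lt_top
      (ENNReal.rpow_lt_top_of_nonneg hp0.le hbdd.ne)).ne
  have hB : ∀ j k m, |cavg n j (u k) m| ≤ (B j).toReal := by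
    intro j k m
    have h1 := enorm_cavg n j hp (hmem k) m
    have h2 : ∫⁻ y, ‖u k y‖ₑ ^ p ≤ K ^ p := by
      have h3 := ENNReal.rpow_le_rpow (hK1 k) hp0.le
      rw [eLpNorm_eq_lintegral_rpow_enorm_toReal (by simpa using hp0) (by simp),
        ENNReal.toReal_ofReal hp0.le, ← ENNReal.rpow_mul, one_div_mul_cancel hp0.ne',
        ENNReal.rpow_one] at h3
      exact h3
    have h4 := ENNReal.rpow_le_rpow (h1.trans (mul_le_mul_right h2 _)) (one_div_nonneg.2 hp0.le)
    rw [← ENNReal.rpow_mul, mul_one_div_cancel hp0.ne', ENNReal.rpow_one] at h4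
    rw [← Real.norm_eq_abs, ← toReal_enorm]
    exact ENNReal.toReal_mono (hBtop j).ne h4
  -- diagonal extraction
  obtain ⟨a, ha, φ, hφ, hlim⟩ := (isCompact_univ_pi
    (X := fun _ : ℕ × (Fin n → ℤ) => ℝ)
    (s := fun i => Set.Icc (-(B i.1).toReal) (B i.1).toReal)
    (fun i => isCompact_Icc)).tendsto_subseq (x := fun k i => cavg n i.1 (u k) i.2)
    (fun k i _ => abs_le.1 (hB i.1 k i.2))
  rw [tendsto_pi_nhds] at hlim
  have hmem' : ∀ k, MemLp (u k) (ENNReal.ofReal r) (volume.restrict Ω) := by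
    intro k
    haveI : IsFiniteMeasure (volume.restrict Ω) := ⟨by simpa using hΩfin⟩
    have hE : MemLp (Eavg n 0 (u k)) (ENNReal.ofReal r) (volume.restrict Ω) :=
      MemLp.of_bound (measurable_Eavg n 0 (u k)).aestronglyMeasurable (B 0).toReal
        (ae_of_all _ fun x => hB 0 k _)
    have hD : MemLp (u k - Eavg n 0 (u k)) (ENNReal.ofReal r) (volume.restrict Ω) := by
      refine MemLp.restrict _ ⟨((humeas k).sub (measurable_Eavg n 0 (u k))).aestronglyMeasurable,
        (htail (u k) (hmem k) ((hK2 k).trans_lt hbdd) 0).trans_lt ?_⟩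
      simp only [pow_zero, mul_one]
      exact ENNReal.mul_lt_top hC ((hK2 k).trans_lt hbdd)
    have := hD.add hE
    rwa [sub_add_cancel] at this
  have hma : ∀ J, Measurable (fun x => a (J, cidx n J x)) := fun J =>
    (Measurable.of_discrete (f := fun m => a (J, m))).comp (measurable_cidx n J)
  obtain ⟨f, hfm, hf⟩ := exists_lim (volume.restrict Ω) (r := ENNReal.ofReal r)
    (by simpa using hr1) (fun k => u (φ k)) (fun k => (humeas _).aestronglyMeasurable)
    (fun J k => Eavg n J (u (φ k))) (fun J k => (measurable_Eavg n J _).aestronglyMeasurable)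
    (fun J x => a (J, cidx n J x)) (fun J => (hma J).aestronglyMeasurable)
    (fun k => hmem' _) (fun J => C * K * ρ ^ J)
    (by
      have := ENNReal.Tendsto.const_mul (a := C * K)
        (ENNReal.tendsto_pow_atTop_nhds_zero_of_lt_one hρ)
        (Or.inr (ENNReal.mul_lt_top hC hbdd).ne)
      rwa [mul_zero] at this)
    (by
      intro J k
      refine (eLpNorm_mono_measure _ Measure.restrict_le_self).trans ?_
      refine (htail (u (φ k)) (hmem _) ((hK2 _).trans_lt hbdd) J).trans ?_
      have := hK2 (φ k)
      gcongr)
    (by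
      intro J
      exact tendsto_Eavg n J hr1 Ω hΩfin (fun k => u (φ k)) (fun m => a (J, m)) (B J).toReal
        (fun k m => hB J _ m) (fun m => abs_le.2 (ha (J, m) (Set.mem_univ _)))
        (fun m => hlim (J, m)))
  refine ⟨φ, f, hφ, ?_⟩
  have hle : ∀ k, eLpNorm (fun x => u (φ k) x - f x) (ENNReal.ofReal q) (volume.restrict Ω) ≤
      eLpNorm (u (φ k) - f) (ENNReal.ofReal r) (volume.restrict Ω) *
        volume Ω ^ (1 / q - 1 / r) := by
    intro k
    have := eLpNorm_le_eLpNorm_mul_rpow_measure_univ (μ := volume.restrict Ω)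
      (f := u (φ k) - f) (ENNReal.ofReal_le_ofReal hqr)
      ((humeas _).aestronglyMeasurable.sub hfm)
    rw [Measure.restrict_apply_univ, ENNReal.toReal_ofReal (by linarith),
      ENNReal.toReal_ofReal hr0.le] at this
    exact this
  have hpow : volume Ω ^ (1 / q - 1 / r) ≠ ⊤ := by
    refine (ENNReal.rpow_lt_top_of_nonneg ?_ hΩfin.ne).ne
    rw [sub_nonneg]
    exact one_div_le_one_div_of_le (by linarith) hqr
  have hz := ENNReal.Tendsto.mul_const hf (Or.inr hpow)
  rw [zero_mul] at hz
  exact tendsto_of_tendsto_of_tendsto_of_le_of_le tendsto_const_nhds hz (fun _ => zero_le) hle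

end
end

section
/- (Rellich–Kondrachov theorem for Gagliardo spaces, supercritical case.) Let n ≥ 1, s ∈ (0,1), 1 ≤ p < ∞ with sp > n, let Ω ⊂ ℝⁿ be a bounded open set, and let 0 < μ < μ_s^* = s − n/p. Then every sequence (u_k) of continuous functions u_k : ℝⁿ → ℝ with sup_k ( ‖u_k‖_{L^p(ℝⁿ)} + [u_k]_{W^{s,p}} ) < ∞ has a subsequence whose restrictions to the closure Ω̄ converge in the Hölder norm ‖·‖_{C^{0,μ}(Ω̄)}. -/
open MeasureTheory Filter ENNReal

noncomputable section

/-- The Hölder norm `‖f‖_{C^{0,μ}(K)} = sup_{x ∈ K} |f x| +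
sup_{x ≠ y ∈ K} |f x - f y| / |x - y|^μ`, valued in `ℝ≥0∞`. -/
def holderNorm (n : ℕ) (μ : ℝ) (K : Set (EuclideanSpace ℝ (Fin n)))
    (f : EuclideanSpace ℝ (Fin n) → ℝ) : ℝ≥0∞ :=
  (⨆ x ∈ K, ENNReal.ofReal |f x|) +
    ⨆ x ∈ K, ⨆ y ∈ K, ⨆ _ : x ≠ y, ENNReal.ofReal (|f x - f y| / ‖x - y‖ ^ μ)

lemma convexOn_abs_rpow_aux {p : ℝ} (hp : 1 ≤ p) :
    ConvexOn ℝ Set.univ (fun t : ℝ => |t| ^ p) := by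
  refine ⟨convex_univ, ?_⟩
  intro x _ y _ a b ha hb hab
  have h1 := (convexOn_rpow hp).2 (x := |x|) (abs_nonneg x) (y := |y|) (abs_nonneg y) ha hb hab
  refine le_trans ?_ h1
  apply Real.rpow_le_rpow (abs_nonneg _) _ (by linarith)
  simp only [smul_eq_mul]
  refine (abs_add_le _ _).trans ?_
  rw [abs_mul, abs_mul, abs_of_nonneg ha, abs_of_nonneg hb]

lemma jensen_balls {n : ℕ} {s p : ℝ} (hs0 : 0 < s) (hp : 1 ≤ p)
    {u : EuclideanSpace ℝ (Fin n) → ℝ} (hu : Continuous u) {G : ℝ} (hG0 : 0 ≤ G)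
    (hG : ∫⁻ x, ∫⁻ y, ENNReal.ofReal (|u x - u y| ^ p / ‖x - y‖ ^ ((n : ℝ) + s * p))
      ≤ ENNReal.ofReal G)
    (a b : EuclideanSpace ℝ (Fin n)) {r₁ r₂ d : ℝ} (hr₁ : 0 < r₁) (hr₂ : 0 < r₂)
    (hd : ∀ y ∈ Metric.ball a r₁, ∀ z ∈ Metric.ball b r₂, ‖y - z‖ ≤ d) :
    |(⨍ y in Metric.ball a r₁, u y) - ⨍ z in Metric.ball b r₂, u z| ^ p *
      (volume.real (Metric.ball a r₁) * volume.real (Metric.ball b r₂))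
      ≤ d ^ ((n : ℝ) + s * p) * G := by
  have hd0 : 0 ≤ d := (norm_nonneg _).trans
    (hd a (Metric.mem_ball_self hr₁) b (Metric.mem_ball_self hr₂))
  have hE : 0 ≤ (n : ℝ) + s * p := by positivity
  set B₁ := Metric.ball a r₁ with hB₁
  set B₂ := Metric.ball b r₂ with hB₂
  have hv₁ : 0 < volume.real B₁ :=
    ENNReal.toReal_pos (Metric.measure_ball_pos volume a hr₁).ne' measure_ball_lt_top.ne
  have hv₂ : 0 < volume.real B₂ :=
    ENNReal.toReal_pos (Metric.measure_ball_pos volume b hr₂).ne' measure_ball_lt_top.ne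
  have i₁ : IsFiniteMeasure (volume.restrict B₁) := ⟨by simpa using measure_ball_lt_top⟩
  have i₂ : IsFiniteMeasure (volume.restrict B₂) := ⟨by simpa using measure_ball_lt_top⟩
  set ν := (volume.restrict B₁).prod (volume.restrict B₂) with hν
  have hνr : ν.real Set.univ = volume.real B₁ * volume.real B₂ := by
    rw [hν, ← Set.univ_prod_univ, measureReal_prod_prod]
    simp
  have : NeZero ν := ⟨by
    intro h
    rw [h] at hνr
    simp at hνr
    rcases hνr with h | h
    · exact hv₁.ne' h
    · exact hv₂.ne' h⟩
  have hint : ∀ F : EuclideanSpace ℝ (Fin n) × EuclideanSpace ℝ (Fin n) → ℝ,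
      Continuous F → Integrable F ν := by
    intro F hF
    rw [hν, Measure.prod_restrict]
    have hc : IsCompact (Metric.closedBall a r₁ ×ˢ Metric.closedBall b r₂) :=
      (isCompact_closedBall a r₁).prod (isCompact_closedBall b r₂)
    exact (hF.continuousOn.integrableOn_compact hc).mono_set
      (Set.prod_mono Metric.ball_subset_closedBall Metric.ball_subset_closedBall)
  have hint₁ : Integrable u (volume.restrict B₁) :=
    (hu.continuousOn.integrableOn_compact (isCompact_closedBall a r₁)).mono_set
      Metric.ball_subset_closedBall
  have hint₂ : Integrable u (volume.restrict B₂) :=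
    (hu.continuousOn.integrableOn_compact (isCompact_closedBall b r₂)).mono_set
      Metric.ball_subset_closedBall
  have hp0 : 0 < p := by linarith
  have hcF : Continuous (fun z : EuclideanSpace ℝ (Fin n) × EuclideanSpace ℝ (Fin n) =>
      u z.1 - u z.2) := by fun_prop
  have hcg : Continuous (fun t : ℝ => |t| ^ p) :=
    continuous_abs.rpow_const (fun _ => Or.inr hp0.le)
  have hJ := (convexOn_abs_rpow_aux hp).map_average_le (μ := ν)
    (f := fun z => u z.1 - u z.2) hcg.continuousOn isClosed_univ (by simp) (hint _ hcF)
    (hint _ (hcg.comp hcF))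
  have hav : ⨍ z, (u z.1 - u z.2) ∂ν = (⨍ y in B₁, u y) - ⨍ z in B₂, u z := by
    rw [average_eq, hνr, setAverage_eq, setAverage_eq, hν, integral_prod _ (hint _ hcF)]
    have : ∀ x, ∫ y, (u x - u y) ∂(volume.restrict B₂)
        = volume.real B₂ * u x - ∫ y in B₂, u y := by
      intro x
      rw [integral_sub (integrable_const _) hint₂]
      simp
    simp_rw [this]
    rw [integral_sub (hint₁.const_mul _) (integrable_const _), integral_const_mul]
    simp
    field_simp
  rw [hav, average_eq (μ := ν), hνr, smul_eq_mul] at hJ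
  have hV : 0 < volume.real B₁ * volume.real B₂ := by positivity
  have h2 : ∫ z, |u z.1 - u z.2| ^ p ∂ν ≤ d ^ ((n : ℝ) + s * p) * G := by
    have hRHS : 0 ≤ d ^ ((n : ℝ) + s * p) * G := by positivity
    rw [← ENNReal.ofReal_le_ofReal_iff hRHS,
      ofReal_integral_eq_lintegral_ofReal (f := fun z => |u z.1 - u z.2| ^ p)
        (hint _ (hcg.comp hcF)) (ae_of_all _ fun z => Real.rpow_nonneg (abs_nonneg _) _), hν,
      lintegral_prod _ (by
        exact (ENNReal.continuous_ofReal.comp (hcg.comp hcF)).measurable.aemeasurable)]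
    calc ∫⁻ x in B₁, ∫⁻ y in B₂, ENNReal.ofReal (|u x - u y| ^ p)
        ≤ ∫⁻ x in B₁, ∫⁻ y in B₂, ENNReal.ofReal (d ^ ((n : ℝ) + s * p)) *
          ENNReal.ofReal (|u x - u y| ^ p / ‖x - y‖ ^ ((n : ℝ) + s * p)) := by
          refine setLIntegral_mono' measurableSet_ball fun x hx => ?_
          refine setLIntegral_mono' measurableSet_ball fun y hy => ?_
          rw [← ENNReal.ofReal_mul (by positivity)]
          apply ENNReal.ofReal_le_ofReal
          rcases eq_or_ne x y with rfl | hxy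
          · simp [Real.zero_rpow hp0.ne']
          · have hpos : 0 < ‖x - y‖ := norm_pos_iff.2 (sub_ne_zero.2 hxy)
            rw [mul_div_assoc', le_div_iff₀ (by positivity), mul_comm]
            gcongr
            exact hd x hx y hy
      _ ≤ ∫⁻ x, ∫⁻ y, ENNReal.ofReal (d ^ ((n : ℝ) + s * p)) *
          ENNReal.ofReal (|u x - u y| ^ p / ‖x - y‖ ^ ((n : ℝ) + s * p)) := by
          refine (setLIntegral_le_lintegral _ _).trans ?_
          exact lintegral_mono fun x => setLIntegral_le_lintegral _ _
      _ = ENNReal.ofReal (d ^ ((n : ℝ) + s * p)) * ∫⁻ x, ∫⁻ y,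
          ENNReal.ofReal (|u x - u y| ^ p / ‖x - y‖ ^ ((n : ℝ) + s * p)) := by
          simp_rw [lintegral_const_mul' _ _ ENNReal.ofReal_ne_top]
      _ ≤ _ := by
          rw [ENNReal.ofReal_mul (by positivity)]
          gcongr
  calc _ ≤ ((volume.real B₁ * volume.real B₂)⁻¹ * ∫ z, |u z.1 - u z.2| ^ p ∂ν) *
        (volume.real B₁ * volume.real B₂) := by gcongr
    _ = ∫ z, |u z.1 - u z.2| ^ p ∂ν := by field_simp
    _ ≤ _ := h2

lemma volume_real_ball_aux {n : ℕ} (a : EuclideanSpace ℝ (Fin n)) {r : ℝ} (hr : 0 < r) :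
    volume.real (Metric.ball a r) =
      r ^ n * volume.real (Metric.ball (0 : EuclideanSpace ℝ (Fin n)) 1) := by
  rw [measureReal_def, Measure.addHaar_ball_of_pos volume a hr, ENNReal.toReal_mul,
    ENNReal.toReal_ofReal (by positivity)]
  simp [measureReal_def]

lemma exists_compare_const {n : ℕ} {s p : ℝ} (hs0 : 0 < s) (hp : 1 ≤ p) {G : ℝ} (hG0 : 0 ≤ G) :
    ∃ M : ℝ, 0 ≤ M ∧ ∀ u : EuclideanSpace ℝ (Fin n) → ℝ, Continuous u →
    (∫⁻ x, ∫⁻ y, ENNReal.ofReal (|u x - u y| ^ p / ‖x - y‖ ^ ((n : ℝ) + s * p))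
      ≤ ENNReal.ofReal G) →
    ∀ (a b : EuclideanSpace ℝ (Fin n)) (r r₁ r₂ : ℝ), 0 < r → r / 2 ≤ r₁ → r₁ ≤ r →
      r / 2 ≤ r₂ → r₂ ≤ r → dist a b ≤ r →
      |(⨍ y in Metric.ball a r₁, u y) - ⨍ z in Metric.ball b r₂, u z|
        ≤ M * r ^ (s - n / p) := by
  have hp0 : 0 < p := by linarith
  set ω := volume.real (Metric.ball (0 : EuclideanSpace ℝ (Fin n)) 1) with hω
  have hω0 : 0 < ω :=
    ENNReal.toReal_pos (Metric.measure_ball_pos volume 0 one_pos).ne' measure_ball_lt_top.ne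
  set K : ℝ := 3 ^ ((n : ℝ) + s * p) * 4 ^ n / ω ^ 2 * G with hK
  have hK0 : 0 ≤ K := by positivity
  refine ⟨K ^ (1 / p), by positivity, ?_⟩
  intro u hu hG a b r r₁ r₂ hr h1 h1' h2 h2' hab
  have hr₁ : 0 < r₁ := by linarith
  have hr₂ : 0 < r₂ := by linarith
  have hJ := jensen_balls hs0 hp hu hG0 hG a b (d := 3 * r) hr₁ hr₂ (by
    intro y hy z hz
    rw [← dist_eq_norm]
    rw [Metric.mem_ball] at hy hz
    have := dist_triangle4_right y z a b
    have := dist_triangle4 y a b z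
    rw [dist_comm b z] at this
    linarith)
  rw [volume_real_ball_aux a hr₁, volume_real_ball_aux b hr₂, ← hω] at hJ
  set D := |(⨍ y in Metric.ball a r₁, u y) - ⨍ z in Metric.ball b r₂, u z| with hD
  have hD0 : 0 ≤ D := abs_nonneg _
  have hlow : (r / 2) ^ n * ω * ((r / 2) ^ n * ω) ≤ r₁ ^ n * ω * (r₂ ^ n * ω) := by
    gcongr
  have h3 : D ^ p * ((r / 2) ^ n * ω * ((r / 2) ^ n * ω)) ≤ (3 * r) ^ ((n : ℝ) + s * p) * G :=
    (mul_le_mul_of_nonneg_left hlow (by positivity)).trans hJ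
  have h4 : D ^ p ≤ K * r ^ (s * p - n) := by
    have e1 : (3 * r) ^ ((n : ℝ) + s * p) * G =
        (K * r ^ (s * p - n)) * ((r / 2) ^ n * ω * ((r / 2) ^ n * ω)) := by
      rw [Real.mul_rpow (by norm_num) hr.le, hK, Real.rpow_add hr, Real.rpow_sub hr,
        Real.rpow_natCast]
      have : (4 : ℝ) ^ n = 2 ^ n * 2 ^ n := by rw [← mul_pow]; norm_num
      rw [this, div_pow]
      field_simp
    rw [e1] at h3
    exact le_of_mul_le_mul_right h3 (by positivity)
  have h5 := Real.rpow_le_rpow (by positivity) h4 (by positivity : 0 ≤ 1 / p)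
  rw [← Real.rpow_mul hD0, mul_one_div_cancel hp0.ne', Real.rpow_one,
    Real.mul_rpow hK0 (by positivity), ← Real.rpow_mul hr.le] at h5
  convert h5 using 3
  field_simp

lemma tendsto_ball_average {n : ℕ} {u : EuclideanSpace ℝ (Fin n) → ℝ} (hu : Continuous u)
    (x : EuclideanSpace ℝ (Fin n)) {r : ℕ → ℝ} (hr : ∀ k, 0 < r k)
    (hlim : Tendsto r atTop (nhds 0)) :
    Tendsto (fun k => ⨍ y in Metric.ball x (r k), u y) atTop (nhds (u x)) := by
  rw [Metric.tendsto_atTop']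
  intro ε hε
  obtain ⟨δ, hδ, h⟩ := Metric.continuous_iff.1 hu x (ε / 2) (by positivity)
  obtain ⟨N, hN⟩ := Filter.eventually_atTop.1 (hlim.eventually_lt_const hδ)
  refine ⟨N, fun k hk => ?_⟩
  have hm : (⨍ y in Metric.ball x (r k), u y) ∈ Metric.closedBall (u x) (ε / 2) := by
    refine (convex_closedBall _ _).set_average_mem Metric.isClosed_closedBall
      (Metric.measure_ball_pos volume x (hr k)).ne' measure_ball_lt_top.ne ?_ ?_
    · refine (ae_restrict_iff' measurableSet_ball).2 (ae_of_all _ fun y hy => ?_)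
      exact (h y ((Metric.mem_ball.1 hy).trans (hN k hk.le))).le
    · exact (hu.continuousOn.integrableOn_compact (isCompact_closedBall x (r k))).mono_set
        Metric.ball_subset_closedBall
  have := Metric.mem_closedBall.1 hm
  linarith

lemma exists_morrey_const {n : ℕ} {s p : ℝ} (hs0 : 0 < s) (hp : 1 ≤ p)
    (hα : 0 < s - n / p) {G : ℝ} (hG0 : 0 ≤ G) :
    ∃ C : ℝ, 0 ≤ C ∧ ∀ u : EuclideanSpace ℝ (Fin n) → ℝ, Continuous u →
    (∫⁻ x, ∫⁻ y, ENNReal.ofReal (|u x - u y| ^ p / ‖x - y‖ ^ ((n : ℝ) + s * p))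
      ≤ ENNReal.ofReal G) →
    ∀ x y : EuclideanSpace ℝ (Fin n), |u x - u y| ≤ C * ‖x - y‖ ^ (s - n / p) := by
  obtain ⟨M, hM0, hM⟩ := exists_compare_const (n := n) hs0 hp hG0
  set α := s - n / p with hαdef
  set q : ℝ := (1 / 2) ^ α with hq
  have hq1 : q < 1 := Real.rpow_lt_one (by norm_num) (by norm_num) hα
  have hq1' : 0 < 1 - q := by linarith
  refine ⟨M + 2 * (M / (1 - q)), by positivity, ?_⟩
  intro u hu hG x y
  have hM' := hM u hu hG
  have key : ∀ (x : EuclideanSpace ℝ (Fin n)) (r : ℝ), 0 < r →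
      |(⨍ z in Metric.ball x r, u z) - u x| ≤ M / (1 - q) * r ^ α := by
    intro x r hr
    have hpos : ∀ k : ℕ, 0 < r * (1 / 2) ^ k := fun k => by positivity
    have hlim : Tendsto (fun k : ℕ => r * (1 / 2 : ℝ) ^ k) atTop (nhds 0) := by
      simpa using (tendsto_pow_atTop_nhds_zero_of_lt_one (r := (1 / 2 : ℝ)) (by norm_num)
        (by norm_num)).const_mul r
    have ht := tendsto_ball_average hu x hpos hlim
    have := dist_le_of_le_geometric_of_tendsto₀ q (M * r ^ α) hq1 (fun k => ?_) ht
    · simp only [pow_zero, mul_one, Real.dist_eq] at this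
      rwa [mul_div_right_comm] at this
    · have h := hM' x x (r * (1 / 2) ^ k) (r * (1 / 2) ^ k) (r * (1 / 2) ^ (k + 1))
        (hpos k) (by linarith [hpos k]) le_rfl (by rw [pow_succ]; linarith)
        (by rw [pow_succ]; linarith [hpos k]) (by rw [dist_self]; exact (hpos k).le)
      rw [Real.dist_eq]
      refine h.trans (le_of_eq ?_)
      rw [Real.mul_rpow hr.le (by positivity), hq, ← Real.rpow_natCast, ← Real.rpow_mul
        (by norm_num), ← Real.rpow_natCast, ← Real.rpow_mul (by norm_num), mul_comm α, mul_assoc]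
  rcases eq_or_ne x y with rfl | hxy
  · simp; positivity
  have hr : 0 < ‖x - y‖ := norm_pos_iff.2 (sub_ne_zero.2 hxy)
  have k1 := key x _ hr
  have k2 := key y _ hr
  have k3 := hM' x y ‖x - y‖ ‖x - y‖ ‖x - y‖ hr (by linarith) le_rfl (by linarith) le_rfl
    (dist_eq_norm x y).le
  rw [abs_le] at *
  constructor <;> nlinarith

lemma exists_point_bound {n : ℕ} {p : ℝ} (hp : 1 ≤ p) {M : ℝ} (hM : 0 ≤ M) :
    ∃ T : ℝ, 0 ≤ T ∧ ∀ u : EuclideanSpace ℝ (Fin n) → ℝ, Continuous u →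
      eLpNorm u (ENNReal.ofReal p) volume ≤ ENNReal.ofReal M →
      ∀ x, ∃ y, ‖x - y‖ ≤ 1 ∧ |u y| ≤ T := by
  have hp0 : 0 < p := by linarith
  set ω := volume.real (Metric.ball (0 : EuclideanSpace ℝ (Fin n)) 1) with hω
  have hω0 : 0 < ω :=
    ENNReal.toReal_pos (Metric.measure_ball_pos volume 0 one_pos).ne' measure_ball_lt_top.ne
  have hX : 0 ≤ (M ^ p + 1) / ω := by positivity
  refine ⟨((M ^ p + 1) / ω) ^ (1 / p), by positivity, ?_⟩
  intro u hu h x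
  by_contra! hcon
  set T := ((M ^ p + 1) / ω) ^ (1 / p) with hT
  have hT0 : 0 ≤ T := by positivity
  have h1 := mul_meas_ge_le_pow_eLpNorm' volume (p := ENNReal.ofReal p) (by simpa using hp0)
    ENNReal.ofReal_ne_top hu.aestronglyMeasurable (ENNReal.ofReal T)
  rw [ENNReal.toReal_ofReal hp0.le] at h1
  have hsub : Metric.ball x 1 ⊆ {y | ENNReal.ofReal T ≤ ‖u y‖ₑ} := by
    intro y hy
    rw [Metric.mem_ball, dist_comm, dist_eq_norm] at hy
    have := (hcon y hy.le).le
    simp only [Set.mem_ofPred_eq]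
    rw [← ofReal_norm, Real.norm_eq_abs]
    exact ENNReal.ofReal_le_ofReal this
  have h2 : ENNReal.ofReal T ^ p * volume (Metric.ball x 1) ≤ ENNReal.ofReal M ^ p :=
    (mul_le_mul_right (measure_mono hsub) _).trans (h1.trans (by gcongr))
  have h3 : volume (Metric.ball x 1) = ENNReal.ofReal ω := by
    rw [hω, ofReal_measureReal measure_ball_lt_top.ne, Measure.addHaar_ball_center]
  rw [h3, ENNReal.ofReal_rpow_of_nonneg hT0 hp0.le, ENNReal.ofReal_rpow_of_nonneg hM hp0.le,
    ← ENNReal.ofReal_mul (by positivity), ENNReal.ofReal_le_ofReal_iff (by positivity), hT,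
    ← Real.rpow_mul hX, one_div_mul_cancel hp0.ne', Real.rpow_one, div_mul_cancel₀ _ hω0.ne'] at h2
  linarith

lemma holderNorm_le_interp {n : ℕ} {μ α : ℝ} (hμ0 : 0 < μ) (hμα : μ < α)
    {K : Set (EuclideanSpace ℝ (Fin n))} {w : EuclideanSpace ℝ (Fin n) → ℝ} {ε H : ℝ}
    (hH : 0 ≤ H) (hε : 0 ≤ ε) (h1 : ∀ x ∈ K, |w x| ≤ ε)
    (h2 : ∀ x ∈ K, ∀ y ∈ K, |w x - w y| ≤ H * ‖x - y‖ ^ α) :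
    holderNorm n μ K w ≤ ENNReal.ofReal (ε + H ^ (μ / α) * (2 * ε) ^ (1 - μ / α)) := by
  have hα : 0 < α := hμ0.trans hμα
  have hθ1 : 0 < 1 - μ / α := by
    have : μ / α < 1 := (div_lt_one hα).2 hμα
    linarith
  rw [ENNReal.ofReal_add hε (by positivity)]
  unfold holderNorm
  refine add_le_add ?_ ?_
  · exact iSup₂_le fun x hx => ENNReal.ofReal_le_ofReal (h1 x hx)
  · refine iSup₂_le fun x hx => iSup₂_le fun y hy => iSup_le fun hxy => ?_
    apply ENNReal.ofReal_le_ofReal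
    have hr : 0 < ‖x - y‖ := norm_pos_iff.2 (sub_ne_zero.2 hxy)
    rw [div_le_iff₀ (by positivity)]
    set D := |w x - w y| with hD
    have hD0 : 0 ≤ D := abs_nonneg _
    have hD2 : D ≤ 2 * ε := by
      have a1 := h1 x hx
      have a2 := h1 y hy
      have := abs_sub (w x) (w y)
      linarith
    have e : D = D ^ (μ / α) * D ^ (1 - μ / α) := by
      rw [← Real.rpow_add_of_nonneg hD0 (by positivity) hθ1.le]
      simp
    have hθ0 : 0 ≤ μ / α := by positivity
    calc D = D ^ (μ / α) * D ^ (1 - μ / α) := e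
      _ ≤ (H * ‖x - y‖ ^ α) ^ (μ / α) * (2 * ε) ^ (1 - μ / α) := by
          gcongr
          exact h2 x hx y hy
      _ = _ := by
          rw [Real.mul_rpow hH (by positivity), ← Real.rpow_mul hr.le, mul_div_cancel₀ _ hα.ne']
          ring

/-- Rellich–Kondrachov theorem for Gagliardo spaces, supercritical case `sp > n`:
`W^{s,p}(ℝⁿ) ↪↪ C^{0,μ}(Ω̄)` for `0 < μ < μ_s^* = s - n/p`. -/
theorem gagliardo_compact_embedding_supercritical
    (n : ℕ) (hn : 1 ≤ n) (s p : ℝ) (hs0 : 0 < s) (hs1 : s < 1)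
    (hp : 1 ≤ p) (hsp : (n : ℝ) < s * p)
    (Ω : Set (EuclideanSpace ℝ (Fin n))) (hΩopen : IsOpen Ω)
    (hΩbdd : Bornology.IsBounded Ω)
    (μ : ℝ) (hμ0 : 0 < μ) (hμ : μ < s - n / p)
    (u : ℕ → EuclideanSpace ℝ (Fin n) → ℝ)
    (hucont : ∀ k, Continuous (u k))
    (hbdd : (⨆ k, eLpNorm (u k) (ENNReal.ofReal p) volume
        + gagliardoSeminorm n s p (u k)) < ⊤) :
    ∃ (φ : ℕ → ℕ) (f : EuclideanSpace ℝ (Fin n) → ℝ), StrictMono φ ∧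
      Tendsto (fun j => holderNorm n μ (closure Ω) (fun x => u (φ j) x - f x))
        atTop (nhds 0) := by
  have hp0 : 0 < p := by linarith
  have hα : 0 < s - n / p := hμ0.trans hμ
  set S : ℝ := (⨆ k, eLpNorm (u k) (ENNReal.ofReal p) volume
        + gagliardoSeminorm n s p (u k)).toReal with hS
  have hS0 : 0 ≤ S := ENNReal.toReal_nonneg
  have hSk : ∀ k, eLpNorm (u k) (ENNReal.ofReal p) volume
        + gagliardoSeminorm n s p (u k) ≤ ENNReal.ofReal S := by
    intro k
    rw [hS, ENNReal.ofReal_toReal hbdd.ne]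
    exact le_iSup (fun k => eLpNorm (u k) (ENNReal.ofReal p) volume
        + gagliardoSeminorm n s p (u k)) k
  have hL : ∀ k, eLpNorm (u k) (ENNReal.ofReal p) volume ≤ ENNReal.ofReal S :=
    fun k => le_self_add.trans (hSk k)
  have hI : ∀ k, ∫⁻ x, ∫⁻ y,
      ENNReal.ofReal (|u k x - u k y| ^ p / ‖x - y‖ ^ ((n : ℝ) + s * p))
      ≤ ENNReal.ofReal (S ^ p) := by
    intro k
    have h : gagliardoSeminorm n s p (u k) ≤ ENNReal.ofReal S := le_add_self.trans (hSk k)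
    unfold gagliardoSeminorm at h
    rw [← ENNReal.ofReal_rpow_of_nonneg hS0 hp0.le]
    rw [one_div] at h
    exact (ENNReal.rpow_inv_le_iff hp0).1 h
  obtain ⟨C, hC0, hC⟩ := exists_morrey_const (n := n) hs0 hp hα
    (G := S ^ p) (by positivity)
  obtain ⟨T, hT0, hT⟩ := exists_point_bound (n := n) hp hS0
  set α := s - n / p with hαdef
  have hHol : ∀ k x y, |u k x - u k y| ≤ C * ‖x - y‖ ^ α :=
    fun k => hC (u k) (hucont k) (hI k)
  have hsup : ∀ k x, |u k x| ≤ T + C := by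
    intro k x
    obtain ⟨y, hy, hyT⟩ := hT (u k) (hucont k) (hL k) x
    have h1 := hHol k x y
    have h2 : ‖x - y‖ ^ α ≤ 1 := Real.rpow_le_one (norm_nonneg _) hy hα.le
    have h3 : C * ‖x - y‖ ^ α ≤ C := mul_le_of_le_one_right hC0 h2
    have h4 := abs_sub_abs_le_abs_sub (u k x) (u k y)
    linarith
  set K := closure Ω with hK
  have hKc : IsCompact K := hΩbdd.isCompact_closure
  have : CompactSpace K := isCompact_iff_compactSpace.1 hKc
  let F : ℕ → BoundedContinuousFunction K ℝ := fun k =>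
    BoundedContinuousFunction.mkOfCompact ⟨fun x => u k x, (hucont k).comp continuous_subtype_val⟩
  have hFv : ∀ k (x : K), F k x = u k x := fun k x => rfl
  have hcomp : IsCompact (closure (Set.range F)) := by
    refine BoundedContinuousFunction.arzela_ascoli (Metric.closedBall 0 (T + C))
      (isCompact_closedBall _ _) _ ?_ ?_
    · rintro _ x ⟨k, rfl⟩
      rw [mem_closedBall_zero_iff, Real.norm_eq_abs, hFv]
      exact hsup k x
    · refine Metric.equicontinuous_of_continuity_modulus (fun t => C * t ^ α) ?_ _ ?_
      · have : ContinuousAt (fun t : ℝ => C * t ^ α) 0 :=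
          continuousAt_const.mul (Real.continuousAt_rpow_const _ _ (Or.inr hα.le))
        simpa [ContinuousAt, Real.zero_rpow hα.ne'] using this
      · rintro x y ⟨_, k, rfl⟩
        rw [Real.dist_eq, Subtype.dist_eq, dist_eq_norm]
        exact hHol k x y
  obtain ⟨g, -, φ, hφ, hlim⟩ := hcomp.tendsto_subseq (x := F)
    (fun k => subset_closure ⟨k, rfl⟩)
  classical
  let f : EuclideanSpace ℝ (Fin n) → ℝ := fun x => if h : x ∈ K then g ⟨x, h⟩ else 0
  have hf : ∀ x (h : x ∈ K), f x = g ⟨x, h⟩ := fun x h => dif_pos h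
  have hd : Tendsto (fun j => dist (F (φ j)) g) atTop (nhds 0) :=
    tendsto_iff_dist_tendsto_zero.1 hlim
  have hptd : ∀ j, ∀ x ∈ K, |u (φ j) x - f x| ≤ dist (F (φ j)) g := by
    intro j x hx
    rw [hf x hx, ← Real.dist_eq]
    exact BoundedContinuousFunction.dist_coe_le_dist (f := F (φ j)) (g := g) ⟨x, hx⟩
  have hpt : ∀ x ∈ K, Tendsto (fun j => u (φ j) x) atTop (nhds (f x)) := by
    intro x hx
    rw [tendsto_iff_dist_tendsto_zero]
    exact squeeze_zero (fun _ => dist_nonneg) (fun j => hptd j x hx) hd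
  have hfHol : ∀ x ∈ K, ∀ y ∈ K, |f x - f y| ≤ C * ‖x - y‖ ^ α := by
    intro x hx y hy
    exact le_of_tendsto ((hpt x hx).sub (hpt y hy)).abs
      (Eventually.of_forall fun j => hHol (φ j) x y)
  refine ⟨φ, f, hφ, ?_⟩
  have hb : ∀ j, holderNorm n μ K (fun x => u (φ j) x - f x) ≤
      ENNReal.ofReal (dist (F (φ j)) g +
        (2 * C) ^ (μ / α) * (2 * dist (F (φ j)) g) ^ (1 - μ / α)) := by
    intro j
    refine holderNorm_le_interp hμ0 hμ (by positivity) dist_nonneg (hptd j) ?_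
    intro x hx y hy
    have h1 := hHol (φ j) x y
    have h2 := hfHol x hx y hy
    have h3 := abs_sub (u (φ j) x - u (φ j) y) (f x - f y)
    have h4 : u (φ j) x - f x - (u (φ j) y - f y) =
      u (φ j) x - u (φ j) y - (f x - f y) := by ring
    rw [h4]
    linarith
  have hθ1 : 0 < 1 - μ / α := by
    have : μ / α < 1 := (div_lt_one hα).2 hμ
    linarith
  have hlim0 : Tendsto (fun t : ℝ => t + (2 * C) ^ (μ / α) * (2 * t) ^ (1 - μ / α))
      (nhds 0) (nhds 0) := by
    have : Continuous (fun t : ℝ => t + (2 * C) ^ (μ / α) * (2 * t) ^ (1 - μ / α)) :=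
      continuous_id.add (continuous_const.mul
        ((continuous_const.mul continuous_id).rpow_const (fun _ => Or.inr hθ1.le)))
    simpa [Real.zero_rpow hθ1.ne'] using this.tendsto 0
  have hfin := ENNReal.tendsto_ofReal (hlim0.comp hd)
  rw [ENNReal.ofReal_zero] at hfin
  exact tendsto_of_tendsto_of_tendsto_of_le_of_le tendsto_const_nhds hfin
    (fun _ => zero_le) hb

end
end
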